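/- arXiv:2308.08280 — 2 statements merged into one kernel-verified Lean document; each statement's English description precedes it below -/
import Mathlib

section
/- A priori estimates for the damped compressible Euler system (Lemma 6.1): There exist constants ε₁ > 0 and C₀ > 0 (independent of T and of the data) such that the following holds. Let T > 0 and let (ρ,u) be a classical solution of the damped compressible Euler system on ℝ × [0,T) satisfying the smallness condition sup_{0<t<T} ‖(ρ−ρ̄, u)(t)‖_{H²} ≤ ε₁. Define X(t) := ‖(ρ−ρ̄,u)(t)‖²_{H²} + t‖u(t)‖²_{L²} + t‖∂ₓ(ρ−ρ̄,u)(t)‖²_{L²} + ∫₀ᵗ (‖∂ₓ(ρ−ρ̄)(τ)‖²_{H¹} + ‖u(τ)‖²_{H²} + τ‖∂ₓu(τ)‖²_{L²}) dτ. Then X(t) ≤ C₀ ‖(ρ₀−ρ̄, u₀)‖²_{H²} for all 0 < t < T. -/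
open MeasureTheory

noncomputable section

/-- Squared `L²` norm of a scalar function. -/
def sqL2 (f : ℝ → ℝ) : ℝ := ∫ x, (f x) ^ 2

/-- Squared `H¹` norm. -/
def sqH1 (f : ℝ → ℝ) : ℝ := sqL2 f + sqL2 (deriv f)

/-- Squared `H²` norm. -/
def sqH2 (f : ℝ → ℝ) : ℝ := sqH1 f + sqL2 (deriv (deriv f))

/-- Squared `H²` norm of a pair. -/
def sqH2pair (f g : ℝ → ℝ) : ℝ := sqH2 f + sqH2 g

/-- A classical solution of the damped compressible Euler system
`∂ₜρ + ∂ₓ(ρu) = 0`, `∂ₜ(ρu) + ∂ₓ(ρu²) + ∂ₓP(ρ) = −λρu` on `ℝ × [0,T)`: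
a smooth positive-density pair, with `(ρ−ρ̄,u)` Schwartz in `x` locally uniformly in
`t`, solving the system (time is the first argument). -/
structure IsEulerSolution (P : ℝ → ℝ) (lam ρbar T : ℝ) (ρ u : ℝ → ℝ → ℝ) : Prop where
  rho_pos : ∀ t x : ℝ, 0 ≤ t → t < T → 0 < ρ t x
  smooth_rho : ContDiff ℝ (⊤ : ℕ∞) (fun p : ℝ × ℝ => ρ p.1 p.2)
  smooth_u : ContDiff ℝ (⊤ : ℕ∞) (fun p : ℝ × ℝ => u p.1 p.2)
  decay : ∀ (k m : ℕ) (T' : ℝ), T' < T → ∃ C : ℝ, ∀ t : ℝ, 0 ≤ t → t ≤ T' → ∀ x : ℝ,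
      |x| ^ k * (|iteratedDeriv m (fun y => ρ t y - ρbar) x| +
        |iteratedDeriv m (fun y => u t y) x|) ≤ C
  mass : ∀ t x : ℝ, 0 ≤ t → t < T →
      deriv (fun s => ρ s x) t + deriv (fun y => ρ t y * u t y) x = 0
  momentum : ∀ t x : ℝ, 0 ≤ t → t < T →
      deriv (fun s => ρ s x * u s x) t + deriv (fun y => ρ t y * (u t y) ^ 2) x +
          deriv (fun y => P (ρ t y)) x = -(lam * (ρ t x * u t x))

/-- A global-in-time classical solution of the damped compressible Euler system. -/
structure IsGlobalEulerSolution (P : ℝ → ℝ) (lam ρbar : ℝ) (ρ u : ℝ → ℝ → ℝ) :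
    Prop where
  rho_pos : ∀ t x : ℝ, 0 ≤ t → 0 < ρ t x
  smooth_rho : ContDiff ℝ (⊤ : ℕ∞) (fun p : ℝ × ℝ => ρ p.1 p.2)
  smooth_u : ContDiff ℝ (⊤ : ℕ∞) (fun p : ℝ × ℝ => u p.1 p.2)
  decay : ∀ (k m : ℕ) (T' : ℝ), ∃ C : ℝ, ∀ t : ℝ, 0 ≤ t → t ≤ T' → ∀ x : ℝ,
      |x| ^ k * (|iteratedDeriv m (fun y => ρ t y - ρbar) x| +
        |iteratedDeriv m (fun y => u t y) x|) ≤ C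
  mass : ∀ t x : ℝ, 0 ≤ t →
      deriv (fun s => ρ s x) t + deriv (fun y => ρ t y * u t y) x = 0
  momentum : ∀ t x : ℝ, 0 ≤ t →
      deriv (fun s => ρ s x * u s x) t + deriv (fun y => ρ t y * (u t y) ^ 2) x +
          deriv (fun y => P (ρ t y)) x = -(lam * (ρ t x * u t x))

/-- The functional `X(t)` of Lemma 6.1. -/
def Xfun (ρbar : ℝ) (ρ u : ℝ → ℝ → ℝ) (t : ℝ) : ℝ :=
  sqH2pair (fun x => ρ t x - ρbar) (u t) + t * sqL2 (u t) +
    t * (sqL2 (deriv fun x => ρ t x - ρbar) + sqL2 (deriv (u t))) +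
    ∫ τ in (0 : ℝ)..t,
      (sqH1 (deriv fun x => ρ τ x - ρbar) + sqH2 (u τ) + τ * sqL2 (deriv (u τ)))

open Set Filter Topology

/-- Smoothness is inherited by the derivative in the second variable. -/
lemma contDiff_slice_deriv {f : ℝ → ℝ → ℝ}
    (hf : ContDiff ℝ (⊤ : ℕ∞) (fun p : ℝ × ℝ => f p.1 p.2)) :
    ContDiff ℝ (⊤ : ℕ∞) (fun p : ℝ × ℝ => deriv (f p.1) p.2) := by
  have h1 : ContDiff ℝ (⊤ : ℕ∞) (fderiv ℝ (fun p : ℝ × ℝ => f p.1 p.2)) :=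
    hf.fderiv_right (by simp)
  have h2 := h1.clm_apply (contDiff_const (c := ((0 : ℝ), (1 : ℝ))))
  convert h2 using 2 with p
  have h3 := (hf.differentiable (by simp) p).hasFDerivAt
  exact (h3.comp_hasDerivAt p.2
    ((hasDerivAt_const p.2 p.1).prodMk (hasDerivAt_id p.2))).deriv

lemma contDiff_slice_iteratedDeriv {f : ℝ → ℝ → ℝ}
    (hf : ContDiff ℝ (⊤ : ℕ∞) (fun p : ℝ × ℝ => f p.1 p.2)) (k : ℕ) :
    ContDiff ℝ (⊤ : ℕ∞) (fun p : ℝ × ℝ => iteratedDeriv k (f p.1) p.2) := by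
  induction k with
  | zero => simpa using hf
  | succ k ih =>
    have := contDiff_slice_deriv (f := fun t x => iteratedDeriv k (f t) x) ih
    simpa only [iteratedDeriv_succ] using this

lemma hasDerivAt_slice_snd {f : ℝ → ℝ → ℝ}
    (hf : ContDiff ℝ (⊤ : ℕ∞) (fun p : ℝ × ℝ => f p.1 p.2)) (t x : ℝ) :
    HasDerivAt (f t) (deriv (f t) x) x := by
  have : ContDiff ℝ (⊤ : ℕ∞) (f t) := hf.comp (contDiff_const.prodMk contDiff_id)
  exact (this.differentiable (by simp) x).hasDerivAt

lemma hasDerivAt_slice_fst {f : ℝ → ℝ → ℝ}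
    (hf : ContDiff ℝ (⊤ : ℕ∞) (fun p : ℝ × ℝ => f p.1 p.2)) (t x : ℝ) :
    HasDerivAt (fun s => f s x) (deriv (fun s => f s x) t) t := by
  have : ContDiff ℝ (⊤ : ℕ∞) (fun s => f s x) := hf.comp (contDiff_id.prodMk contDiff_const)
  exact (this.differentiable (by simp) t).hasDerivAt

/-- Mixed partial derivatives commute: if `∂ₜ f (t, ·) = φ` then `∂ₜ ∂ₓ f (t, x) = φ' (x)`. -/
lemma hasDerivAt_fst_slice_deriv {f : ℝ → ℝ → ℝ}
    (hf : ContDiff ℝ (⊤ : ℕ∞) (fun p : ℝ × ℝ => f p.1 p.2)) {t x : ℝ} {φ : ℝ → ℝ} {φ' : ℝ}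
    (hφ : ∀ y, HasDerivAt (fun s => f s y) (φ y) t) (hφ' : HasDerivAt φ φ' x) :
    HasDerivAt (fun s => deriv (f s) x) φ' t := by
  set F : ℝ × ℝ → ℝ := fun p => f p.1 p.2 with hF
  have h1 : ContDiff ℝ (⊤ : ℕ∞) (fderiv ℝ F) := hf.fderiv_right (by simp)
  have hsymm : IsSymmSndFDerivAt ℝ F (t, x) :=
    hf.contDiffAt.isSymmSndFDerivAt (by
      rw [minSmoothness_of_isRCLikeNormedField]
      exact WithTop.coe_le_coe.2 (le_top : (2 : ℕ∞) ≤ ⊤))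
  have hd : ∀ p, HasFDerivAt F (fderiv ℝ F p) p := fun p =>
    (hf.differentiable (by simp) p).hasFDerivAt
  have hd2 : HasFDerivAt (fderiv ℝ F) (fderiv ℝ (fderiv ℝ F) (t, x)) (t, x) :=
    (h1.differentiable (by simp) (t, x)).hasFDerivAt
  have l1 : ∀ s y : ℝ, HasDerivAt (fun s => ((s, y) : ℝ × ℝ)) (1, 0) s := fun s y =>
    (hasDerivAt_id s).prodMk (hasDerivAt_const s y)
  have l2 : ∀ s y : ℝ, HasDerivAt (fun y => ((s, y) : ℝ × ℝ)) (0, 1) y := fun s y =>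
    (hasDerivAt_const y s).prodMk (hasDerivAt_id y)
  have e1 : ∀ s y, deriv (f s) y = fderiv ℝ F (s, y) (0, 1) := fun s y =>
    HasDerivAt.deriv ((hd (s, y)).comp_hasDerivAt y (l2 s y))
  have e2 : ∀ y, φ y = fderiv ℝ F (t, y) (1, 0) := fun y =>
    (hφ y).unique
      (HasFDerivAt.comp_hasDerivAt (f := fun s => ((s, y) : ℝ × ℝ)) t (hd (t, y)) (l1 t y))
  have h3 : HasDerivAt (fun s => fderiv ℝ F (s, x) (0, 1))
      (fderiv ℝ (fderiv ℝ F) (t, x) (1, 0) (0, 1)) t := by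
    have h : HasDerivAt (fun s => fderiv ℝ F (s, x)) (fderiv ℝ (fderiv ℝ F) (t, x) (1, 0)) t :=
      hd2.comp_hasDerivAt t (l1 t x)
    simpa using h.clm_apply (hasDerivAt_const t ((0 : ℝ), (1 : ℝ)))
  have h4 : HasDerivAt (fun y => fderiv ℝ F (t, y) (1, 0))
      (fderiv ℝ (fderiv ℝ F) (t, x) (0, 1) (1, 0)) x := by
    have h : HasDerivAt (fun y => fderiv ℝ F (t, y)) (fderiv ℝ (fderiv ℝ F) (t, x) (0, 1)) x :=
      hd2.comp_hasDerivAt x (l2 t x)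
    simpa using h.clm_apply (hasDerivAt_const x ((1 : ℝ), (0 : ℝ)))
  rw [show φ = fun y => fderiv ℝ F (t, y) (1, 0) from funext e2] at hφ'
  rw [hφ'.unique h4, hsymm (0, 1) (1, 0)]
  simpa only [e1] using h3

/-- `f` is continuous on the strip `[0,T) × ℝ` and bounded on each `[0,T'] × ℝ`, `T' < T`. -/
structure BddStrip (T : ℝ) (f : ℝ → ℝ → ℝ) : Prop where
  cont : ContinuousOn (fun p : ℝ × ℝ => f p.1 p.2) (Ico 0 T ×ˢ univ)
  bdd : ∀ T' < T, ∃ C, ∀ t, 0 ≤ t → t ≤ T' → ∀ x, |f t x| ≤ C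

/-- `f` is continuous on the strip `[0,T) × ℝ` and decays like `(1 + x²)⁻¹` uniformly on each
`[0,T'] × ℝ`, `T' < T`. -/
structure DecStrip (T : ℝ) (f : ℝ → ℝ → ℝ) : Prop where
  cont : ContinuousOn (fun p : ℝ × ℝ => f p.1 p.2) (Ico 0 T ×ˢ univ)
  dec : ∀ T' < T, ∃ C, ∀ t, 0 ≤ t → t ≤ T' → ∀ x, |f t x| ≤ C * (1 + x ^ 2)⁻¹

section Strip

variable {T : ℝ} {f g : ℝ → ℝ → ℝ}

lemma BddStrip.const (c : ℝ) : BddStrip T (fun _ _ => c) :=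
  ⟨continuousOn_const, fun _ _ => ⟨|c|, fun _ _ _ _ => le_rfl⟩⟩

lemma BddStrip.add (hf : BddStrip T f) (hg : BddStrip T g) :
    BddStrip T (fun t x => f t x + g t x) := by
  refine ⟨hf.cont.add hg.cont, fun T' hT' => ?_⟩
  obtain ⟨A, hA⟩ := hf.bdd T' hT'
  obtain ⟨B, hB⟩ := hg.bdd T' hT'
  exact ⟨A + B, fun t h0 h1 x => (abs_add_le _ _).trans (add_le_add (hA t h0 h1 x) (hB t h0 h1 x))⟩

lemma BddStrip.mul (hf : BddStrip T f) (hg : BddStrip T g) :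
    BddStrip T (fun t x => f t x * g t x) := by
  refine ⟨hf.cont.mul hg.cont, fun T' hT' => ?_⟩
  obtain ⟨A, hA⟩ := hf.bdd T' hT'
  obtain ⟨B, hB⟩ := hg.bdd T' hT'
  refine ⟨A * B, fun t h0 h1 x => ?_⟩
  rw [abs_mul]
  exact mul_le_mul (hA t h0 h1 x) (hB t h0 h1 x) (abs_nonneg _)
    ((abs_nonneg _).trans (hA t h0 h1 x))

lemma BddStrip.neg (hf : BddStrip T f) : BddStrip T (fun t x => -f t x) :=
  ⟨hf.cont.neg, fun T' hT' => by simpa only [abs_neg] using hf.bdd T' hT'⟩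

lemma BddStrip.pow (hf : BddStrip T f) (k : ℕ) : BddStrip T (fun t x => f t x ^ k) := by
  induction k with
  | zero => simpa using BddStrip.const 1
  | succ k ih => simpa only [pow_succ] using ih.mul hf

lemma DecStrip.bddStrip (hf : DecStrip T f) : BddStrip T f := by
  refine ⟨hf.cont, fun T' hT' => ?_⟩
  obtain ⟨C, hC⟩ := hf.dec T' hT'
  refine ⟨C, fun t h0 h1 x => (hC t h0 h1 x).trans ?_⟩
  have hx := (abs_nonneg _).trans (hC t h0 h1 x)
  have h2 : (0 : ℝ) < (1 + x ^ 2)⁻¹ := by positivity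
  have hC0 : 0 ≤ C := nonneg_of_mul_nonneg_left hx h2
  exact mul_le_of_le_one_right hC0 (inv_le_one_of_one_le₀ (by nlinarith [sq_nonneg x]))

lemma DecStrip.add (hf : DecStrip T f) (hg : DecStrip T g) :
    DecStrip T (fun t x => f t x + g t x) := by
  refine ⟨hf.cont.add hg.cont, fun T' hT' => ?_⟩
  obtain ⟨A, hA⟩ := hf.dec T' hT'
  obtain ⟨B, hB⟩ := hg.dec T' hT'
  refine ⟨A + B, fun t h0 h1 x => (abs_add_le _ _).trans ?_⟩
  rw [add_mul]
  exact add_le_add (hA t h0 h1 x) (hB t h0 h1 x)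

lemma DecStrip.mul_bdd (hf : DecStrip T f) (hg : BddStrip T g) :
    DecStrip T (fun t x => f t x * g t x) := by
  refine ⟨hf.cont.mul hg.cont, fun T' hT' => ?_⟩
  obtain ⟨A, hA⟩ := hf.dec T' hT'
  obtain ⟨B, hB⟩ := hg.bdd T' hT'
  refine ⟨A * B, fun t h0 h1 x => ?_⟩
  rw [abs_mul, mul_right_comm]
  exact mul_le_mul (hA t h0 h1 x) (hB t h0 h1 x) (abs_nonneg _)
    ((abs_nonneg _).trans (hA t h0 h1 x))

lemma DecStrip.bdd_mul (hf : BddStrip T f) (hg : DecStrip T g) :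
    DecStrip T (fun t x => f t x * g t x) := by
  simpa only [mul_comm] using hg.mul_bdd hf

lemma DecStrip.neg (hf : DecStrip T f) : DecStrip T (fun t x => -f t x) :=
  ⟨hf.cont.neg, fun T' hT' => by simpa only [abs_neg] using hf.dec T' hT'⟩

lemma DecStrip.sub (hf : DecStrip T f) (hg : DecStrip T g) :
    DecStrip T (fun t x => f t x - g t x) := by
  simpa only [sub_eq_add_neg] using hf.add hg.neg

lemma DecStrip.pow_succ (hf : DecStrip T f) (k : ℕ) : DecStrip T (fun t x => f t x ^ (k + 1)) := by
  simpa only [_root_.pow_succ] using DecStrip.bdd_mul (hf.bddStrip.pow k) hf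

lemma DecStrip.sq (hf : DecStrip T f) : DecStrip T (fun t x => f t x ^ 2) := hf.pow_succ 1

lemma DecStrip.continuous_slice (hf : DecStrip T f) {t : ℝ} (h0 : 0 ≤ t) (hT : t < T) :
    Continuous (f t) := by
  have : ContinuousOn (f t) univ :=
    hf.cont.comp (f := fun x : ℝ => (t, x)) (by fun_prop) (fun x _ => ⟨⟨h0, hT⟩, mem_univ _⟩)
  simpa using this

lemma DecStrip.integrable (hf : DecStrip T f) {t : ℝ} (h0 : 0 ≤ t) (hT : t < T) :
    Integrable (f t) := by
  obtain ⟨C, hC⟩ := hf.dec t hT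
  exact (integrable_inv_one_add_sq.const_mul C).mono'
    (hf.continuous_slice h0 hT).aestronglyMeasurable
    (ae_of_all _ fun x => by simpa using hC t h0 le_rfl x)

lemma tendsto_inv_one_add_sq_cocompact :
    Tendsto (fun x : ℝ => (1 + x ^ 2)⁻¹) (cocompact ℝ) (𝓝 0) := by
  refine tendsto_inv_atTop_zero.comp (tendsto_atTop_add_const_left _ _ ?_)
  have := (tendsto_pow_atTop (α := ℝ) two_ne_zero).comp (tendsto_norm_cocompact_atTop (E := ℝ))
  refine this.congr fun x => ?_
  simp

lemma DecStrip.tendsto_zero (hf : DecStrip T f) {t : ℝ} (h0 : 0 ≤ t) (hT : t < T) :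
    Tendsto (f t) (cocompact ℝ) (𝓝 0) := by
  obtain ⟨C, hC⟩ := hf.dec t hT
  refine squeeze_zero_norm (fun x => hC t h0 le_rfl x) ?_
  simpa using tendsto_inv_one_add_sq_cocompact.const_mul C

lemma DecStrip.integral_deriv_eq_zero {f' : ℝ → ℝ → ℝ} (hf : DecStrip T f) (hf' : DecStrip T f')
    {t : ℝ} (h0 : 0 ≤ t) (hT : t < T) (hd : ∀ x, HasDerivAt (f t) (f' t x) x) :
    ∫ x, f' t x = 0 := by
  have h := hf.tendsto_zero h0 hT
  rw [cocompact_eq_atBot_atTop] at h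
  simpa using integral_of_hasDerivAt_of_tendsto hd (hf'.integrable h0 hT)
    (h.mono_left le_sup_left) (h.mono_left le_sup_right)

/-- One-dimensional Sobolev embedding `H¹ ⊂ L^∞`. -/
lemma DecStrip.sq_le_integral {f' : ℝ → ℝ → ℝ} (hf : DecStrip T f) (hf' : DecStrip T f')
    {t : ℝ} (h0 : 0 ≤ t) (hT : t < T) (hd : ∀ x, HasDerivAt (f t) (f' t x) x) (x : ℝ) :
    f t x ^ 2 ≤ (∫ y, f t y ^ 2) + ∫ y, f' t y ^ 2 := by
  have hsq := hf.sq
  have hint : Integrable (fun y => 2 * f t y * f' t y) :=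
    (DecStrip.bdd_mul ((BddStrip.const 2).mul hf.bddStrip) hf').integrable h0 hT
  have h := hsq.tendsto_zero h0 hT
  rw [cocompact_eq_atBot_atTop] at h
  have hd2 : ∀ y, HasDerivAt (fun y => f t y ^ 2) (2 * f t y * f' t y) y := fun y => by
    simpa using (hd y).fun_pow 2
  have e := integral_Iic_of_hasDerivAt_of_tendsto (a := x)
    (hd2 x).continuousAt.continuousWithinAt (fun y _ => hd2 y) hint.integrableOn
    (h.mono_left le_sup_left)
  have i1 := hsq.integrable h0 hT
  have i2 := hf'.sq.integrable h0 hT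
  rw [← integral_add i1 i2]
  have e' : f t x ^ 2 = ∫ y in Iic x, 2 * f t y * f' t y := by rw [e, sub_zero]
  rw [e']
  calc ∫ y in Iic x, 2 * f t y * f' t y ≤ ∫ y in Iic x, (f t y ^ 2 + f' t y ^ 2) :=
        setIntegral_mono hint.integrableOn (i1.add i2).integrableOn
          (fun y => by nlinarith [sq_nonneg (f t y - f' t y)])
    _ ≤ _ := setIntegral_le_integral (i1.add i2) (ae_of_all _ fun y => by positivity)

lemma DecStrip.continuousOn_integral (hf : DecStrip T f) :
    ContinuousOn (fun t => ∫ x, f t x) (Ico 0 T) := by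
  intro t ht
  obtain ⟨T', h1, h2⟩ := exists_between ht.2
  obtain ⟨C, hC⟩ := hf.dec T' h2
  have h : ContinuousOn (fun t => ∫ x, f t x) (Icc 0 T') := by
    refine continuousOn_of_dominated (bound := fun x => C * (1 + x ^ 2)⁻¹) ?_ ?_
      (integrable_inv_one_add_sq.const_mul C) ?_
    · exact fun s hs => (hf.continuous_slice hs.1 (hs.2.trans_lt h2)).aestronglyMeasurable
    · exact fun s hs => ae_of_all _ fun x => hC s hs.1 hs.2 x
    · exact ae_of_all _ fun x => hf.cont.comp (f := fun s : ℝ => (s, x)) (by fun_prop)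
        (fun s hs => ⟨⟨hs.1, hs.2.trans_lt h2⟩, mem_univ _⟩)
  refine (h t ⟨ht.1, h1.le⟩).mono_of_mem_nhdsWithin ?_
  filter_upwards [self_mem_nhdsWithin, mem_nhdsWithin_of_mem_nhds (Iio_mem_nhds h1)] with s hs hs'
  exact ⟨hs.1, le_of_lt hs'⟩

/-- Integrated form of a local balance law `∂ₜ q + ∂ₓ Φ = R`. -/
lemma hasDerivAt_integral_of_balance {q R Φ Φ' : ℝ → ℝ → ℝ} (hq : DecStrip T q)
    (hR : DecStrip T R) (hΦ : DecStrip T Φ) (hΦ' : DecStrip T Φ')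
    (hqt : ∀ t, 0 < t → t < T → ∀ x, HasDerivAt (fun s => q s x) (R t x - Φ' t x) t)
    (hΦx : ∀ t, 0 < t → t < T → ∀ x, HasDerivAt (Φ t) (Φ' t x) x) {t : ℝ} (h0 : 0 < t)
    (hT : t < T) : Integrable (R t) ∧ HasDerivAt (fun s => ∫ x, q s x) (∫ x, R t x) t := by
  refine ⟨hR.integrable h0.le hT, ?_⟩
  obtain ⟨T', h1, h2⟩ := exists_between hT
  have hD := hR.sub hΦ'
  obtain ⟨C, hC⟩ := hD.dec T' h2
  have hnear : Ioo 0 T' ∈ 𝓝 t := Ioo_mem_nhds h0 h1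
  have key := (hasDerivAt_integral_of_dominated_loc_of_deriv_le (μ := volume) (F := q)
    (F' := fun s x => R s x - Φ' s x) (bound := fun x => C * (1 + x ^ 2)⁻¹) hnear
    (by
      filter_upwards [hnear] with s hs
      exact (hq.continuous_slice hs.1.le (hs.2.trans h2)).aestronglyMeasurable)
    (hq.integrable h0.le hT) (hD.continuous_slice h0.le hT).aestronglyMeasurable
    (ae_of_all _ fun x s hs => hC s hs.1.le hs.2.le x)
    (integrable_inv_one_add_sq.const_mul C)
    (ae_of_all _ fun x s hs => hqt s hs.1 (hs.2.trans h2) x)).2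
  rwa [integral_sub (hR.integrable h0.le hT) (hΦ'.integrable h0.le hT),
    hΦ.integral_deriv_eq_zero hΦ' h0.le hT (hΦx t h0 hT), sub_zero] at key

end Strip

/-- The spatial jets `r k = ∂ₓᵏ (ρ - ρ̄)`, `u k = ∂ₓᵏ u` of a solution of the damped Euler system in
the form `∂ₜρ + ∂ₓ(ρu) = 0`, `∂ₜu + u ∂ₓu + A ∂ₓρ + λu = 0`, where `A = a(ρ)`, `A₁ = a'(ρ)`,
`A₂ = a''(ρ)`; the coefficients are bounded by `m`, `M` and the low order jets by `δ`. -/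
structure EulerJet (lam T m M δ : ℝ) (ρ A A₁ A₂ : ℝ → ℝ → ℝ) (r u : ℕ → ℝ → ℝ → ℝ) : Prop where
  bddρ : BddStrip T ρ
  bddA : BddStrip T A
  bddA₁ : BddStrip T A₁
  bddA₂ : BddStrip T A₂
  decr : ∀ k, DecStrip T (r k)
  decu : ∀ k, DecStrip T (u k)
  rx : ∀ k t x, HasDerivAt (r k t) (r (k + 1) t x) x
  ux : ∀ k t x, HasDerivAt (u k t) (u (k + 1) t x) x
  ρx : ∀ t x, HasDerivAt (ρ t) (r 1 t x) x
  Ax : ∀ t x, 0 < t → t < T → HasDerivAt (A t) (A₁ t x * r 1 t x) x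
  A₁x : ∀ t x, 0 < t → t < T → HasDerivAt (A₁ t) (A₂ t x * r 1 t x) x
  ρt : ∀ t x, 0 < t → t < T →
    HasDerivAt (fun s => ρ s x) (-(r 1 t x * u 0 t x + ρ t x * u 1 t x)) t
  At : ∀ t x, 0 < t → t < T →
    HasDerivAt (fun s => A s x) (-(A₁ t x * (r 1 t x * u 0 t x + ρ t x * u 1 t x))) t
  r0t : ∀ t x, 0 < t → t < T →
    HasDerivAt (fun s => r 0 s x) (-(u 0 t x * r 1 t x + ρ t x * u 1 t x)) t
  r1t : ∀ t x, 0 < t → t < T → HasDerivAt (fun s => r 1 s x)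
    (-(u 0 t x * r 2 t x + ρ t x * u 2 t x) - 2 * (r 1 t x * u 1 t x)) t
  r2t : ∀ t x, 0 < t → t < T → HasDerivAt (fun s => r 2 s x)
    (-(u 0 t x * r 3 t x + ρ t x * u 3 t x) - 3 * (r 2 t x * u 1 t x + r 1 t x * u 2 t x)) t
  u0t : ∀ t x, 0 < t → t < T → HasDerivAt (fun s => u 0 s x)
    (-(u 0 t x * u 1 t x + A t x * r 1 t x + lam * u 0 t x)) t
  u1t : ∀ t x, 0 < t → t < T → HasDerivAt (fun s => u 1 s x)
    (-(u 0 t x * u 2 t x + A t x * r 2 t x + lam * u 1 t x)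
      - (u 1 t x * u 1 t x + A₁ t x * r 1 t x * r 1 t x)) t
  u2t : ∀ t x, 0 < t → t < T → HasDerivAt (fun s => u 2 s x)
    (-(u 0 t x * u 3 t x + A t x * r 3 t x + lam * u 2 t x)
      - (3 * (u 1 t x * u 2 t x) + 3 * (A₁ t x * r 1 t x * r 2 t x)
        + A₂ t x * r 1 t x * r 1 t x * r 1 t x)) t
  le_ρ : ∀ t x, 0 ≤ t → t < T → m ≤ ρ t x
  ρ_le : ∀ t x, 0 ≤ t → t < T → ρ t x ≤ M
  le_A : ∀ t x, 0 ≤ t → t < T → m ≤ A t x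
  A_le : ∀ t x, 0 ≤ t → t < T → A t x ≤ M
  A₁_le : ∀ t x, 0 ≤ t → t < T → |A₁ t x| ≤ M
  A₂_le : ∀ t x, 0 ≤ t → t < T → |A₂ t x| ≤ M
  r0_le : ∀ t x, 0 ≤ t → t < T → |r 0 t x| ≤ δ
  r1_le : ∀ t x, 0 ≤ t → t < T → |r 1 t x| ≤ δ
  u1_le : ∀ t x, 0 ≤ t → t < T → |u 1 t x| ≤ δ

lemma decStrip_of_schwartz {T : ℝ} {f : ℝ → ℝ → ℝ}
    (hf : Continuous (fun p : ℝ × ℝ => f p.1 p.2))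
    (h0 : ∀ T' < T, ∃ C, ∀ t, 0 ≤ t → t ≤ T' → ∀ x, |f t x| ≤ C)
    (h2 : ∀ T' < T, ∃ C, ∀ t, 0 ≤ t → t ≤ T' → ∀ x, x ^ 2 * |f t x| ≤ C) : DecStrip T f := by
  refine ⟨hf.continuousOn, fun T' hT' => ?_⟩
  obtain ⟨A, hA⟩ := h0 T' hT'
  obtain ⟨B, hB⟩ := h2 T' hT'
  refine ⟨A + B, fun t ht0 ht1 x => ?_⟩
  rw [← div_eq_mul_inv, le_div_iff₀ (by positivity)]
  linarith [hA t ht0 ht1 x, hB t ht0 ht1 x]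

section Solution

variable {P : ℝ → ℝ} {lam ρbar T : ℝ} {ρ u : ℝ → ℝ → ℝ}

lemma IsEulerSolution.contDiff_perturbation (h : IsEulerSolution P lam ρbar T ρ u) :
    ContDiff ℝ (⊤ : ℕ∞) (fun p : ℝ × ℝ => ρ p.1 p.2 - ρbar) :=
  h.smooth_rho.sub contDiff_const

lemma IsEulerSolution.decStrip_rho (h : IsEulerSolution P lam ρbar T ρ u) (k : ℕ) :
    DecStrip T (fun t => iteratedDeriv k (fun y => ρ t y - ρbar)) := by
  refine decStrip_of_schwartz
    (contDiff_slice_iteratedDeriv (f := fun t x => ρ t x - ρbar)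
      h.contDiff_perturbation k).continuous (fun T' hT' => ?_) (fun T' hT' => ?_)
  · obtain ⟨C, hC⟩ := h.decay 0 k T' hT'
    refine ⟨C, fun t h0 h1 x => ?_⟩
    have := hC t h0 h1 x
    rw [pow_zero, one_mul] at this
    linarith [abs_nonneg (iteratedDeriv k (fun y => u t y) x)]
  · obtain ⟨C, hC⟩ := h.decay 2 k T' hT'
    refine ⟨C, fun t h0 h1 x => ?_⟩
    have := hC t h0 h1 x
    rw [sq_abs] at this
    nlinarith [mul_nonneg (sq_nonneg x) (abs_nonneg (iteratedDeriv k (fun y => u t y) x))]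

lemma IsEulerSolution.decStrip_u (h : IsEulerSolution P lam ρbar T ρ u) (k : ℕ) :
    DecStrip T (fun t => iteratedDeriv k (u t)) := by
  refine decStrip_of_schwartz
    (contDiff_slice_iteratedDeriv h.smooth_u k).continuous (fun T' hT' => ?_) (fun T' hT' => ?_)
  · obtain ⟨C, hC⟩ := h.decay 0 k T' hT'
    refine ⟨C, fun t h0 h1 x => ?_⟩
    have := hC t h0 h1 x
    rw [pow_zero, one_mul] at this
    linarith [abs_nonneg (iteratedDeriv k (fun y => ρ t y - ρbar) x)]
  · obtain ⟨C, hC⟩ := h.decay 2 k T' hT'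
    refine ⟨C, fun t h0 h1 x => ?_⟩
    have := hC t h0 h1 x
    rw [sq_abs] at this
    nlinarith [mul_nonneg (sq_nonneg x) (abs_nonneg (iteratedDeriv k (fun y => ρ t y - ρbar) x))]

lemma bddStrip_comp {c : ℝ → ℝ} {m M B : ℝ} (hm : 0 < m) (hc : ContinuousOn c (Ioi 0))
    (hB : ∀ s ∈ Icc m M, |c s| ≤ B) (hρ : Continuous (fun p : ℝ × ℝ => ρ p.1 p.2))
    (hρm : ∀ t x, 0 ≤ t → t < T → ρ t x ∈ Icc m M) : BddStrip T (fun t x => c (ρ t x)) := by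
  refine ⟨hc.comp hρ.continuousOn fun p hp => hm.trans_le (hρm p.1 p.2 hp.1.1 hp.1.2).1,
    fun T' hT' => ⟨B, fun t h0 h1 x => hB _ (hρm t x h0 (h1.trans_lt hT'))⟩⟩

/-- A solution of the Euler system with values close to equilibrium has bounded jets. -/
lemma IsEulerSolution.eulerJet (h : IsEulerSolution P lam ρbar T ρ u)
    {a a₁ a₂ : ℝ → ℝ} {m b M M' δ : ℝ} (hb : 0 < b) (hmb : m ≤ b) (hMM : M' ≤ M)
    (hPa : ∀ s, 0 < s → HasDerivAt P (s * a s) s)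
    (ha : ∀ s, 0 < s → HasDerivAt a (a₁ s) s) (ha₁ : ∀ s, 0 < s → HasDerivAt a₁ (a₂ s) s)
    (hca₂ : ContinuousOn a₂ (Ioi 0))
    (hle : ∀ s ∈ Icc b M', m ≤ a s) (hB : ∀ s ∈ Icc b M', |a s| ≤ M)
    (hB₁ : ∀ s ∈ Icc b M', |a₁ s| ≤ M) (hB₂ : ∀ s ∈ Icc b M', |a₂ s| ≤ M)
    (hρm : ∀ t x, 0 ≤ t → t < T → ρ t x ∈ Icc b M')
    (hr0 : ∀ t x, 0 ≤ t → t < T → |ρ t x - ρbar| ≤ δ)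
    (hr1 : ∀ t x, 0 ≤ t → t < T → |deriv (fun y => ρ t y - ρbar) x| ≤ δ)
    (hu1 : ∀ t x, 0 ≤ t → t < T → |deriv (u t) x| ≤ δ) :
    EulerJet lam T m M δ ρ (fun t x => a (ρ t x)) (fun t x => a₁ (ρ t x)) (fun t x => a₂ (ρ t x))
      (fun k t => iteratedDeriv k (fun y => ρ t y - ρbar)) (fun k t => iteratedDeriv k (u t)) := by
  have hcρ := h.smooth_rho.continuous
  have hca : ContinuousOn a (Ioi 0) := fun s hs => (ha s hs).continuousAt.continuousWithinAt
  have hca₁ : ContinuousOn a₁ (Ioi 0) := fun s hs => (ha₁ s hs).continuousAt.continuousWithinAt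
  set r : ℕ → ℝ → ℝ → ℝ := fun k t => iteratedDeriv k (fun y => ρ t y - ρbar) with hr
  set v : ℕ → ℝ → ℝ → ℝ := fun k t => iteratedDeriv k (u t) with hv
  have sr : ∀ k, ContDiff ℝ (⊤ : ℕ∞) (fun p : ℝ × ℝ => r k p.1 p.2) :=
    contDiff_slice_iteratedDeriv (f := fun t x => ρ t x - ρbar) h.contDiff_perturbation
  have sv : ∀ k, ContDiff ℝ (⊤ : ℕ∞) (fun p : ℝ × ℝ => v k p.1 p.2) :=
    contDiff_slice_iteratedDeriv h.smooth_u
  have r_succ : ∀ k t, r (k + 1) t = deriv (r k t) := fun k t => iteratedDeriv_succ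
  have v_succ : ∀ k t, v (k + 1) t = deriv (v k t) := fun k t => iteratedDeriv_succ
  have r_zero : ∀ t, r 0 t = fun y => ρ t y - ρbar := fun t => iteratedDeriv_zero
  have v_zero : ∀ t, v 0 t = u t := fun t => iteratedDeriv_zero
  have rx : ∀ k t x, HasDerivAt (r k t) (r (k + 1) t x) x := fun k t x => by
    rw [r_succ]; exact hasDerivAt_slice_snd (sr k) t x
  have vx : ∀ k t x, HasDerivAt (v k t) (v (k + 1) t x) x := fun k t x => by
    rw [v_succ]; exact hasDerivAt_slice_snd (sv k) t x
  have ρx : ∀ t x, HasDerivAt (ρ t) (r 1 t x) x := fun t x => by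
    simpa [r_zero] using (rx 0 t x).add_const ρbar
  have u0x : ∀ t x, HasDerivAt (u t) (v 1 t x) x := fun t x => by
    simpa [v_zero] using vx 0 t x
  have Px : ∀ {c c' : ℝ → ℝ} (_ : ∀ s, 0 < s → HasDerivAt c (c' s) s) (t x : ℝ), 0 ≤ t → t < T →
      HasDerivAt (fun y => c (ρ t y)) (c' (ρ t x) * r 1 t x) x := fun hc t x h0 hT =>
    (hc _ (h.rho_pos t x h0 hT)).comp x (ρx t x)
  have ρt : ∀ t x, 0 ≤ t → t < T →
      HasDerivAt (fun s => ρ s x) (-(r 1 t x * v 0 t x + ρ t x * v 1 t x)) t := by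
    intro t x h0 hT
    have h1 := hasDerivAt_slice_fst h.smooth_rho t x
    have h2 := h.mass t x h0 hT
    rw [((ρx t x).fun_mul (u0x t x)).deriv] at h2
    convert h1 using 1
    simp only [v_zero]
    linarith
  have u0t : ∀ t x, 0 ≤ t → t < T → HasDerivAt (fun s => v 0 s x)
      (-(v 0 t x * v 1 t x + a (ρ t x) * r 1 t x + lam * v 0 t x)) t := by
    intro t x h0 hT
    have h1 := hasDerivAt_slice_fst h.smooth_u t x
    have h2 := h.momentum t x h0 hT
    rw [((ρt t x h0 hT).fun_mul h1).deriv, ((ρx t x).fun_mul ((u0x t x).fun_pow 2)).deriv,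
      (Px hPa t x h0 hT).deriv] at h2
    simp only [v_zero] at h2 ⊢
    convert h1 using 1
    refine mul_left_cancel₀ (h.rho_pos t x h0 hT).ne' ?_
    push_cast at h2
    linear_combination (-1) * h2
  have r0t : ∀ t x, 0 ≤ t → t < T →
      HasDerivAt (fun s => r 0 s x) (-(v 0 t x * r 1 t x + ρ t x * v 1 t x)) t := by
    intro t x h0 hT
    simp only [r_zero]
    exact ((ρt t x h0 hT).sub_const ρbar).congr_deriv (by ring)
  have r1t : ∀ t x, 0 ≤ t → t < T → HasDerivAt (fun s => r 1 s x)
      (-(v 0 t x * r 2 t x + ρ t x * v 2 t x) - 2 * (r 1 t x * v 1 t x)) t := by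
    intro t x h0 hT
    simp only [r_succ 0]
    refine hasDerivAt_fst_slice_deriv (sr 0) (fun y => r0t t y h0 hT) ?_
    refine (((vx 0 t x).fun_mul (rx 1 t x)).fun_add ((ρx t x).fun_mul (vx 1 t x))).fun_neg
      |>.congr_deriv ?_
    rw [← r_succ 0]
    ring
  have r2t : ∀ t x, 0 ≤ t → t < T → HasDerivAt (fun s => r 2 s x)
      (-(v 0 t x * r 3 t x + ρ t x * v 3 t x) - 3 * (r 2 t x * v 1 t x + r 1 t x * v 2 t x)) t := by
    intro t x h0 hT
    have key := hasDerivAt_fst_slice_deriv (x := x) (sr 1) (fun y => r1t t y h0 hT)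
      (((((vx 0 t x).fun_mul (rx 2 t x)).fun_add ((ρx t x).fun_mul (vx 2 t x))).fun_neg).fun_sub
        (((rx 1 t x).fun_mul (vx 1 t x)).const_mul 2))
    simp only [r_succ 1]
    refine key.congr_deriv ?_
    simp only [← r_succ]
    ring
  have u1t : ∀ t x, 0 ≤ t → t < T → HasDerivAt (fun s => v 1 s x)
      (-(v 0 t x * v 2 t x + a (ρ t x) * r 2 t x + lam * v 1 t x)
        - (v 1 t x * v 1 t x + a₁ (ρ t x) * r 1 t x * r 1 t x)) t := by
    intro t x h0 hT
    have key := hasDerivAt_fst_slice_deriv (x := x) (sv 0) (fun y => u0t t y h0 hT)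
      (((((vx 0 t x).fun_mul (vx 1 t x)).fun_add ((Px ha t x h0 hT).fun_mul (rx 1 t x))).fun_add
        ((vx 0 t x).const_mul lam)).fun_neg)
    simp only [v_succ 0]
    refine key.congr_deriv ?_
    simp only [← v_succ]
    ring
  have u2t : ∀ t x, 0 ≤ t → t < T → HasDerivAt (fun s => v 2 s x)
      (-(v 0 t x * v 3 t x + a (ρ t x) * r 3 t x + lam * v 2 t x)
        - (3 * (v 1 t x * v 2 t x) + 3 * (a₁ (ρ t x) * r 1 t x * r 2 t x)
          + a₂ (ρ t x) * r 1 t x * r 1 t x * r 1 t x)) t := by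
    intro t x h0 hT
    have key := hasDerivAt_fst_slice_deriv (x := x) (sv 1) (fun y => u1t t y h0 hT)
      ((((((vx 0 t x).fun_mul (vx 2 t x)).fun_add ((Px ha t x h0 hT).fun_mul (rx 2 t x))).fun_add
        ((vx 1 t x).const_mul lam)).fun_neg).fun_sub (((vx 1 t x).fun_mul (vx 1 t x)).fun_add
          (((Px ha₁ t x h0 hT).fun_mul (rx 1 t x)).fun_mul (rx 1 t x))))
    simp only [v_succ 1]
    refine key.congr_deriv ?_
    simp only [← v_succ]
    ring
  exact
    { bddρ := bddStrip_comp (c := fun s => s) (B := M') hb continuousOn_id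
        (fun s hs => by rw [abs_of_pos (hb.trans_le hs.1)]; exact hs.2) hcρ hρm
      bddA := bddStrip_comp hb hca hB hcρ hρm
      bddA₁ := bddStrip_comp hb hca₁ hB₁ hcρ hρm
      bddA₂ := bddStrip_comp hb hca₂ hB₂ hcρ hρm
      decr := h.decStrip_rho
      decu := h.decStrip_u
      rx := rx
      ux := vx
      ρx := ρx
      Ax := fun t x h0 hT => Px ha t x h0.le hT
      A₁x := fun t x h0 hT => Px ha₁ t x h0.le hT
      ρt := fun t x h0 hT => ρt t x h0.le hT
      At := fun t x h0 hT => ((ha _ (h.rho_pos t x h0.le hT)).comp t (ρt t x h0.le hT)).congr_deriv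
        (by ring)
      r0t := fun t x h0 hT => r0t t x h0.le hT
      r1t := fun t x h0 hT => r1t t x h0.le hT
      r2t := fun t x h0 hT => r2t t x h0.le hT
      u0t := fun t x h0 hT => u0t t x h0.le hT
      u1t := fun t x h0 hT => u1t t x h0.le hT
      u2t := fun t x h0 hT => u2t t x h0.le hT
      le_ρ := fun t x h0 hT => hmb.trans (hρm t x h0 hT).1
      ρ_le := fun t x h0 hT => (hρm t x h0 hT).2.trans hMM
      le_A := fun t x h0 hT => hle _ (hρm t x h0 hT)
      A_le := fun t x h0 hT => (le_abs_self _).trans (hB _ (hρm t x h0 hT))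
      A₁_le := fun t x h0 hT => hB₁ _ (hρm t x h0 hT)
      A₂_le := fun t x h0 hT => hB₂ _ (hρm t x h0 hT)
      r0_le := fun t x h0 hT => by simpa only [r_zero] using hr0 t x h0 hT
      r1_le := fun t x h0 hT => by rw [r_succ, r_zero]; exact hr1 t x h0 hT
      u1_le := fun t x h0 hT => by rw [v_succ, v_zero]; exact hu1 t x h0 hT }

end Solution

lemma trilinear_le {c s p q B δ d : ℝ} (hc : |c| ≤ B) (hs : |s| ≤ δ)
    (hd : p ^ 2 + q ^ 2 ≤ 2 * d) : c * s * p * q ≤ B * δ * d := by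
  have h1 : |p * q| ≤ d := by
    rw [abs_le]
    constructor <;> nlinarith [sq_nonneg (p + q), sq_nonneg (p - q)]
  have hB := (abs_nonneg _).trans hc
  have hδ := (abs_nonneg _).trans hs
  calc c * s * p * q = c * s * (p * q) := by ring
    _ ≤ |c * s * (p * q)| := le_abs_self _
    _ = |c| * |s| * |p * q| := by rw [abs_mul, abs_mul]
    _ ≤ B * δ * d := by gcongr

lemma young_weighted {lam m M κ : ℝ} (hm : 0 < m) (hlam : m ≤ lam) (hlamM : lam ≤ M)
    (hκ0 : 0 < κ) (hκ : κ * (4 * M ^ 2) = m ^ 3) (p q : ℝ) :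
    κ * (-(lam * p * q)) ≤ κ * m / 2 * q ^ 2 + m ^ 2 / 8 * p ^ 2 := by
  have hl2 : lam ^ 2 ≤ M ^ 2 := pow_le_pow_left₀ (by linarith) hlamM 2
  have h2 : κ * lam ^ 2 ≤ m ^ 3 / 4 := by
    linarith [mul_le_mul_of_nonneg_left hl2 hκ0.le]
  have h3 : m * (κ * (-(lam * p * q))) ≤ m * (κ * m / 2 * q ^ 2 + m ^ 2 / 8 * p ^ 2) := by
    linarith [mul_nonneg hκ0.le (sq_nonneg (m * q + lam * p)),
      mul_nonneg (sq_nonneg p) (sub_nonneg.2 h2)]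
  exact le_of_mul_le_mul_left h3 hm

/-- Dissipation for the quadratic part of the total energy balance. -/
lemma pointwise_dissipation_quadratic {lam m M κ A ρ r₁ r₂ u₀ u₁ u₂ : ℝ} (hm : 0 < m)
    (hm1 : m ≤ 1) (hlam : m ≤ lam) (hlamM : lam ≤ M) (hρ : m ≤ ρ) (hρM : ρ ≤ M)
    (hA : m ≤ A) (hκ0 : 0 < κ) (hκ : κ * (4 * M ^ 2) = m ^ 3) (hκm : 4 * κ ≤ m ^ 2)
    (hκM : 4 * (κ * M) ≤ m ^ 2) :
    -(lam * ρ * u₀ ^ 2) - lam * ρ * u₁ ^ 2 - lam * ρ * u₂ ^ 2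
      + κ * ((-(A * r₁ ^ 2) - lam * u₀ * r₁ + ρ * u₁ ^ 2) +
      (-(A * r₂ ^ 2) - lam * u₁ * r₂ + ρ * u₂ ^ 2))
      ≤ -(κ * m / 2) * (r₁ ^ 2 + r₂ ^ 2 + u₀ ^ 2 + u₁ ^ 2 + u₂ ^ 2) := by
  have hlr : m ^ 2 ≤ lam * ρ := by
    rw [sq]; exact mul_le_mul hlam hρ hm.le (hm.le.trans hlam)
  have c1 := young_weighted hm hlam hlamM hκ0 hκ u₀ r₁
  have c2 := young_weighted hm hlam hlamM hκ0 hκ u₁ r₂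
  have q0 := sq_nonneg u₀
  have q1 := sq_nonneg u₁
  have q2 := sq_nonneg u₂
  have p1 := sq_nonneg r₁
  have p2 := sq_nonneg r₂
  have e0 := mul_le_mul_of_nonneg_right hlr q0
  have e1 := mul_le_mul_of_nonneg_right hlr q1
  have e2 := mul_le_mul_of_nonneg_right hlr q2
  have hκA := mul_le_mul_of_nonneg_left hA hκ0.le
  have f1 := mul_le_mul_of_nonneg_right hκA p1
  have f2 := mul_le_mul_of_nonneg_right hκA p2
  have hκρ : κ * ρ ≤ m ^ 2 / 4 := by
    have := mul_le_mul_of_nonneg_left hρM hκ0.le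
    linarith
  have g1 := mul_le_mul_of_nonneg_right hκρ q1
  have g2 := mul_le_mul_of_nonneg_right hκρ q2
  have hκm2 : κ * m / 2 ≤ m ^ 2 / 8 := by
    have := mul_le_mul_of_nonneg_left hm1 hκ0.le
    linarith
  have k0 := mul_le_mul_of_nonneg_right hκm2 q0
  have k1 := mul_le_mul_of_nonneg_right hκm2 q1
  have k2 := mul_le_mul_of_nonneg_right hκm2 q2
  have n0 := mul_nonneg (sq_nonneg m) q0
  have n1 := mul_nonneg (sq_nonneg m) q1
  have n2 := mul_nonneg (sq_nonneg m) q2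
  linarith

/-- Pointwise dissipation for the total energy, including the cross terms. -/
lemma pointwise_dissipation {lam m M κ δ A A₁ A₂ ρ r₀ r₁ r₂ u₀ u₁ u₂ : ℝ} (hm : 0 < m)
    (hm1 : m ≤ 1) (hM : 1 ≤ M) (hlam : m ≤ lam) (hlamM : lam ≤ M) (hρ : m ≤ ρ) (hρM : ρ ≤ M)
    (hA : m ≤ A) (hAM : A ≤ M) (hA₁ : |A₁| ≤ M) (hA₂ : |A₂| ≤ M) (hr₀ : |r₀| ≤ δ)
    (hr₁ : |r₁| ≤ δ) (hu₁ : |u₁| ≤ δ) (hδ1 : δ ≤ 1) (hκ : κ * (4 * M ^ 2) = m ^ 3)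
    (hδκ : 20 * M ^ 2 * δ ≤ κ * m / 4) :
    (-(lam * ρ * u₀ ^ 2) + (2 * ρ * A₁ * r₀ * r₁ * u₀ + 1 / 2 * ρ * A₂ * r₀ * r₀ * r₁ * u₀)) +
    (-(lam * ρ * u₁ ^ 2) + (1 / 2 * (A - ρ * A₁) * u₁ * r₁ ^ 2 + (A + ρ * A₁) * r₁ * r₁ * u₁
      - A * r₁ * (2 * (r₁ * u₁)) - ρ * u₁ * (u₁ * u₁ + A₁ * r₁ * r₁))) +
    (-(lam * ρ * u₂ ^ 2) + (1 / 2 * (A - ρ * A₁) * u₁ * r₂ ^ 2 + (A + ρ * A₁) * r₁ * r₂ * u₂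
      - A * r₂ * (3 * (r₂ * u₁ + r₁ * u₂))
      - ρ * u₂ * (3 * (u₁ * u₂) + 3 * (A₁ * r₁ * r₂) + A₂ * r₁ * r₁ * r₁))) +
    κ * ((-(A * r₁ ^ 2) - lam * u₀ * r₁ + ρ * u₁ ^ 2) +
      (-(A * r₂ ^ 2) - lam * u₁ * r₂ + ρ * u₂ ^ 2
        + (-(A₁ * r₁ * r₁ * r₂) - u₁ * u₁ * r₂ + 2 * r₁ * u₁ * u₂)))
      ≤ -(κ * m / 4) * (r₁ ^ 2 + r₂ ^ 2 + u₀ ^ 2 + u₁ ^ 2 + u₂ ^ 2) := by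
  set d := r₁ ^ 2 + r₂ ^ 2 + u₀ ^ 2 + u₁ ^ 2 + u₂ ^ 2 with hd
  have q0 := sq_nonneg u₀
  have q1 := sq_nonneg u₁
  have q2 := sq_nonneg u₂
  have p1 := sq_nonneg r₁
  have p2 := sq_nonneg r₂
  have hd0 : 0 ≤ d := by positivity
  have hδ0 : 0 ≤ δ := (abs_nonneg _).trans hr₀
  have hM2 : M ≤ M ^ 2 := by nlinarith
  have hM21 : 1 ≤ M ^ 2 := hM.trans hM2
  have hM0 : 0 < M := by linarith
  have hκ0 : 0 < κ := by
    have : 0 < κ * (4 * M ^ 2) := by rw [hκ]; positivity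
    exact pos_of_mul_pos_left this (by positivity)
  have hmm : m ^ 2 ≤ 1 := by nlinarith
  have hκm : 4 * κ ≤ m ^ 2 := by
    nlinarith [mul_nonneg hκ0.le (by linarith : (0:ℝ) ≤ M ^ 2 - 1),
    mul_nonneg (sq_nonneg m) (by linarith : (0:ℝ) ≤ 1 - m)]
  have hκM : 4 * (κ * M) ≤ m ^ 2 := by
    nlinarith [mul_nonneg hκ0.le (by linarith : (0:ℝ) ≤ M ^ 2 - M),
      mul_nonneg (sq_nonneg m) (by linarith : (0:ℝ) ≤ 1 - m)]
  have hκ1 : κ ≤ 1 := by linarith only [hκm, hmm]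
  have aρ : |ρ| ≤ M := by rw [abs_of_pos (by linarith)]; exact hρM
  have aA : |A| ≤ M := by rw [abs_of_pos (by linarith)]; exact hAM
  have aρ₁ : |ρ * A₁| ≤ M ^ 2 := by rw [abs_mul, sq]; gcongr
  have aρ₂ : |ρ * A₂| ≤ M ^ 2 := by rw [abs_mul, sq]; gcongr
  have lin := pointwise_dissipation_quadratic (r₁ := r₁) (r₂ := r₂) (u₀ := u₀) (u₁ := u₁)
    (u₂ := u₂) hm hm1 hlam hlamM hρ hρM hA hκ0 hκ hκm hκM
  rw [← hd] at lin
  have hrr : |r₀ * r₀| ≤ δ := by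
    rw [abs_mul]; exact (mul_le_of_le_one_right (abs_nonneg _) (hr₀.trans hδ1)).trans hr₀
  have hrr1 : |r₁ * r₁| ≤ δ := by
    rw [abs_mul]; exact (mul_le_of_le_one_right (abs_nonneg _) (hr₁.trans hδ1)).trans hr₁
  have ak : ∀ {c : ℝ}, |c| ≤ M ^ 2 → |κ * c| ≤ M ^ 2 := by
    intro c hc
    rw [abs_mul, abs_of_pos hκ0]
    exact (mul_le_of_le_one_left (abs_nonneg _) hκ1).trans hc
  have t1 := trilinear_le (c := ρ * A₁) (p := r₁) (q := u₀) (d := d) aρ₁ hr₀ (by linarith only [hd, p1, p2, q0, q1, q2])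
  have t2 := trilinear_le (c := ρ * A₂) (p := r₁) (q := u₀) (d := d) aρ₂ hrr (by linarith only [hd, p1, p2, q0, q1, q2])
  have t3 := trilinear_le (c := -(ρ * A₁)) (p := r₁) (q := r₁) (d := d)
    ((abs_neg _).trans_le aρ₁) hu₁ (by linarith only [hd, p1, p2, q0, q1, q2])
  have t4 := trilinear_le (c := -A) (p := r₁) (q := r₁) (d := d)
    ((abs_neg _).trans_le (aA.trans hM2)) hu₁ (by linarith only [hd, p1, p2, q0, q1, q2])
  have t5 := trilinear_le (c := -ρ) (p := u₁) (q := u₁) (d := d)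
    ((abs_neg _).trans_le (aρ.trans hM2)) hu₁ (by linarith only [hd, p1, p2, q0, q1, q2])
  have t6 := trilinear_le (c := -A) (p := r₂) (q := r₂) (d := d)
    ((abs_neg _).trans_le (aA.trans hM2)) hu₁ (by linarith only [hd, p1, p2, q0, q1, q2])
  have t7 := trilinear_le (c := -(ρ * A₁)) (p := r₂) (q := r₂) (d := d)
    ((abs_neg _).trans_le aρ₁) hu₁ (by linarith only [hd, p1, p2, q0, q1, q2])
  have t8 := trilinear_le (c := -A) (p := r₂) (q := u₂) (d := d)
    ((abs_neg _).trans_le (aA.trans hM2)) hr₁ (by linarith only [hd, p1, p2, q0, q1, q2])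
  have t9 := trilinear_le (c := -ρ) (p := u₂) (q := u₂) (d := d)
    ((abs_neg _).trans_le (aρ.trans hM2)) hu₁ (by linarith only [hd, p1, p2, q0, q1, q2])
  have t10 := trilinear_le (c := -(ρ * A₁)) (p := r₂) (q := u₂) (d := d)
    ((abs_neg _).trans_le aρ₁) hr₁ (by linarith only [hd, p1, p2, q0, q1, q2])
  have t11 := trilinear_le (c := -(ρ * A₂)) (p := r₁) (q := u₂) (d := d)
    ((abs_neg _).trans_le aρ₂) hrr1 (by linarith only [hd, p1, p2, q0, q1, q2])
  have t12 := trilinear_le (c := κ * (-A₁)) (p := r₁) (q := r₂) (d := d)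
    (ak ((abs_neg _).trans_le (hA₁.trans hM2))) hr₁ (by linarith only [hd, p1, p2, q0, q1, q2])
  have t13 := trilinear_le (c := κ * (-1)) (p := u₁) (q := r₂) (d := d)
    (ak (by simpa using hM21)) hu₁ (by linarith only [hd, p1, p2, q0, q1, q2])
  have t14 := trilinear_le (c := κ * 1) (p := u₁) (q := u₂) (d := d)
    (ak (by simpa using hM21)) hr₁ (by linarith only [hd, p1, p2, q0, q1, q2])
  have hfin := mul_le_mul_of_nonneg_right hδκ hd0
  have hpos : 0 ≤ M ^ 2 * δ * d := by positivity
  linarith only [lin, t1, t2, t3, t4, t5, t6, t7, t8, t9, t10, t11, t12, t13, t14, hfin, hpos]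

/-- Pointwise dissipation for the first order energy. -/
lemma pointwise_dissipation_first {lam m M δ A A₁ ρ r₁ u₁ : ℝ} (hm : 0 < m)
    (hM : 1 ≤ M) (hlam : m ≤ lam) (hρ : m ≤ ρ) (hρM : ρ ≤ M)
    (hA : m ≤ A) (hAM : A ≤ M) (hA₁ : |A₁| ≤ M) (hu₁ : |u₁| ≤ δ) (hδ : M * δ ≤ m ^ 2 / 4) :
    -(lam * ρ * u₁ ^ 2) + (1 / 2 * (A - ρ * A₁) * u₁ * r₁ ^ 2 + (A + ρ * A₁) * r₁ * r₁ * u₁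
      - A * r₁ * (2 * (r₁ * u₁)) - ρ * u₁ * (u₁ * u₁ + A₁ * r₁ * r₁))
      ≤ -(m ^ 2 / 2) * u₁ ^ 2 + M ^ 4 / m ^ 2 * (r₁ ^ 2 * r₁ ^ 2) := by
  have hlr : m ^ 2 ≤ lam * ρ := by
    rw [sq]; exact mul_le_mul hlam hρ hm.le (hm.le.trans hlam)
  have e1 := mul_le_mul_of_nonneg_right hlr (sq_nonneg u₁)
  have hM0 : 0 < M := by linarith
  have h1 : -(ρ * u₁) ≤ m ^ 2 / 4 := by
    have : -(ρ * u₁) ≤ |ρ * u₁| := neg_le_abs _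
    rw [abs_mul, abs_of_pos (hm.trans_le hρ)] at this
    have h2 : ρ * |u₁| ≤ M * δ := by gcongr
    linarith
  have e2 := mul_le_mul_of_nonneg_right h1 (sq_nonneg u₁)
  set c := -(1 / 2) * (A + ρ * A₁) with hc
  have hcM : |c| ≤ M ^ 2 := by
    have h3 : |ρ * A₁| ≤ M ^ 2 := by
      rw [abs_mul, sq, abs_of_pos (hm.trans_le hρ)]; gcongr
    have := abs_le.1 h3
    rw [abs_le, hc]
    constructor <;> nlinarith
  have e3 : c * u₁ * r₁ ^ 2 ≤ m ^ 2 / 4 * u₁ ^ 2 + M ^ 4 / m ^ 2 * (r₁ ^ 2 * r₁ ^ 2) := by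
    have hc2 : c ^ 2 ≤ M ^ 4 := by
      have := pow_le_pow_left₀ (abs_nonneg c) hcM 2
      rw [sq_abs] at this
      linarith [show (M ^ 2) ^ 2 = M ^ 4 by ring]
    have h4 : m ^ 2 * (c * u₁ * r₁ ^ 2)
        ≤ m ^ 2 * (m ^ 2 / 4 * u₁ ^ 2) + M ^ 4 * (r₁ ^ 2 * r₁ ^ 2) := by
      nlinarith [sq_nonneg (m ^ 2 / 2 * u₁ - c * r₁ ^ 2),
        mul_nonneg (mul_self_nonneg (r₁ ^ 2)) (sub_nonneg.2 hc2)]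
    have hm2 : 0 < m ^ 2 := by positivity
    refine le_of_mul_le_mul_left (h4.trans_eq ?_) hm2
    field_simp
  rw [hc] at e3
  linarith

section Energy

variable {lam T m M δ : ℝ} {ρ A A₁ A₂ : ℝ → ℝ → ℝ} {r u : ℕ → ℝ → ℝ → ℝ}

/-- Weighted energy identity for the linearised system
`fₜ + u fₓ + ρ gₓ = -F`, `gₜ + u gₓ + A fₓ + λ g = -G`. -/
lemma EulerJet.hasDerivAt_energy (J : EulerJet lam T m M δ ρ A A₁ A₂ r u)
    {f f' g g' F G : ℝ → ℝ → ℝ} (df : DecStrip T f) (df' : DecStrip T f') (dg : DecStrip T g)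
    (dg' : DecStrip T g') (dF : DecStrip T F) (dG : DecStrip T G)
    (hfx : ∀ t x, HasDerivAt (f t) (f' t x) x) (hgx : ∀ t x, HasDerivAt (g t) (g' t x) x)
    (hft : ∀ t x, 0 < t → t < T → HasDerivAt (fun s => f s x)
      (-(u 0 t x * f' t x + ρ t x * g' t x) - F t x) t)
    (hgt : ∀ t x, 0 < t → t < T → HasDerivAt (fun s => g s x)
      (-(u 0 t x * g' t x + A t x * f' t x + lam * g t x) - G t x) t)
    {t : ℝ} (h0 : 0 < t) (hT : t < T) :
    Integrable (fun x => (-(lam * ρ t x * g t x ^ 2)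
        + (1 / 2 * (A t x - ρ t x * A₁ t x) * u 1 t x * f t x ^ 2
          + (A t x + ρ t x * A₁ t x) * r 1 t x * f t x * g t x
          - A t x * f t x * F t x - ρ t x * g t x * G t x))) ∧
    HasDerivAt (fun s => ∫ x, 1 / 2 * (A s x * f s x ^ 2 + ρ s x * g s x ^ 2))
      (∫ x, (-(lam * ρ t x * g t x ^ 2)
        + (1 / 2 * (A t x - ρ t x * A₁ t x) * u 1 t x * f t x ^ 2
          + (A t x + ρ t x * A₁ t x) * r 1 t x * f t x * g t x
          - A t x * f t x * F t x - ρ t x * g t x * G t x))) t := by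
  have bρ := J.bddρ
  have bA := J.bddA
  have bA₁ := J.bddA₁
  have du0 := J.decu 0
  have du1 := J.decu 1
  have dr1 := J.decr 1
  refine hasDerivAt_integral_of_balance (T := T)
    (q := fun s x => 1 / 2 * (A s x * f s x ^ 2 + ρ s x * g s x ^ 2))
    (R := fun t x => -(lam * ρ t x * g t x ^ 2)
        + (1 / 2 * (A t x - ρ t x * A₁ t x) * u 1 t x * f t x ^ 2
          + (A t x + ρ t x * A₁ t x) * r 1 t x * f t x * g t x
          - A t x * f t x * F t x - ρ t x * g t x * G t x))
    (Φ := fun t x => 1 / 2 * u 0 t x * (A t x * f t x ^ 2 + ρ t x * g t x ^ 2)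
      + A t x * ρ t x * f t x * g t x)
    (Φ' := fun t x => 1 / 2 * u 1 t x * (A t x * f t x ^ 2 + ρ t x * g t x ^ 2)
      + 1 / 2 * u 0 t x * (A₁ t x * r 1 t x * f t x ^ 2 + 2 * A t x * f t x * f' t x
        + r 1 t x * g t x ^ 2 + 2 * ρ t x * g t x * g' t x)
      + A₁ t x * r 1 t x * ρ t x * f t x * g t x + A t x * r 1 t x * f t x * g t x
      + A t x * ρ t x * f' t x * g t x + A t x * ρ t x * f t x * g' t x)
    ?_ ?_ ?_ ?_ (fun t h0 hT x => ?_) (fun t h0 hT x => ?_) h0 hT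
  case refine_5 =>
    have hA := J.At t x h0 hT
    have hρ := J.ρt t x h0 hT
    exact (((hA.fun_mul ((hft t x h0 hT).fun_pow 2)).fun_add
      (hρ.fun_mul ((hgt t x h0 hT).fun_pow 2))).const_mul (1 / 2)).congr_deriv (by push_cast; ring)
  case refine_6 =>
    have hA := J.Ax t x h0 hT
    have hρ := J.ρx t x
    exact (((((J.ux 0 t x).const_mul (1 / 2))).fun_mul ((hA.fun_mul ((hfx t x).fun_pow 2)).fun_add
      (hρ.fun_mul ((hgx t x).fun_pow 2)))).fun_add
        (((hA.fun_mul hρ).fun_mul (hfx t x)).fun_mul (hgx t x))).congr_deriv (by push_cast; ring)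
  all_goals
    repeat' first
      | assumption
      | exact BddStrip.const _
      | apply DecStrip.add
      | apply DecStrip.sub
      | apply DecStrip.neg
      | apply DecStrip.sq
      | apply DecStrip.bdd_mul
      | apply BddStrip.add
      | apply BddStrip.neg
      | apply BddStrip.mul
      | apply DecStrip.bddStrip

/-- The energy identity for the solution itself, after integrating the quadratic flux by parts. -/
lemma EulerJet.hasDerivAt_energy_zero (J : EulerJet lam T m M δ ρ A A₁ A₂ r u) {t : ℝ}
    (h0 : 0 < t) (hT : t < T) :
    Integrable (fun x => (-(lam * ρ t x * u 0 t x ^ 2)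
        + (2 * ρ t x * A₁ t x * r 0 t x * r 1 t x * u 0 t x
          + 1 / 2 * ρ t x * A₂ t x * r 0 t x * r 0 t x * r 1 t x * u 0 t x))) ∧
    HasDerivAt (fun s => ∫ x, 1 / 2 * (A s x * r 0 s x ^ 2 + ρ s x * u 0 s x ^ 2))
      (∫ x, (-(lam * ρ t x * u 0 t x ^ 2)
        + (2 * ρ t x * A₁ t x * r 0 t x * r 1 t x * u 0 t x
          + 1 / 2 * ρ t x * A₂ t x * r 0 t x * r 0 t x * r 1 t x * u 0 t x))) t := by
  have bρ := J.bddρ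
  have bA := J.bddA
  have bA₁ := J.bddA₁
  have bA₂ := J.bddA₂
  have dr0 := J.decr 0
  have dr1 := J.decr 1
  have dr2 := J.decr 2
  have dr3 := J.decr 3
  have du0 := J.decu 0
  have du1 := J.decu 1
  have du2 := J.decu 2
  have du3 := J.decu 3
  have dz : DecStrip T (fun _ _ => 0) := by simpa using du0.sub du0
  have key := J.hasDerivAt_energy dr0 dr1 du0 du1 dz dz (J.rx 0) (J.ux 0)
    (fun t x h0 hT => (J.r0t t x h0 hT).congr_deriv (by ring))
    (fun t x h0 hT => (J.u0t t x h0 hT).congr_deriv (by ring)) h0 hT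
  have hR : DecStrip T (fun t x => -(lam * ρ t x * u 0 t x ^ 2)
        + (2 * ρ t x * A₁ t x * r 0 t x * r 1 t x * u 0 t x
          + 1 / 2 * ρ t x * A₂ t x * r 0 t x * r 0 t x * r 1 t x * u 0 t x)) := by
    repeat' first
      | assumption
      | exact BddStrip.const _
      | apply DecStrip.add
      | apply DecStrip.sub
      | apply DecStrip.neg
      | apply DecStrip.sq
      | apply DecStrip.bdd_mul
      | apply BddStrip.add
      | apply BddStrip.neg
      | apply BddStrip.mul
      | apply DecStrip.bddStrip
  refine ⟨hR.integrable h0.le hT, key.2.congr_deriv ?_⟩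
  have hflux : ∫ x, ((A t x - ρ t x * A₁ t x) * r 0 t x * r 1 t x * u 0 t x
      - 1 / 2 * ρ t x * A₂ t x * r 0 t x * r 0 t x * r 1 t x * u 0 t x
      + 1 / 2 * (A t x - ρ t x * A₁ t x) * r 0 t x * r 0 t x * u 1 t x) = 0 := by
    refine DecStrip.integral_deriv_eq_zero (T := T)
      (f := fun t x => 1 / 2 * (A t x - ρ t x * A₁ t x) * r 0 t x * r 0 t x * u 0 t x)
      (f' := fun t x => (A t x - ρ t x * A₁ t x) * r 0 t x * r 1 t x * u 0 t x
      - 1 / 2 * ρ t x * A₂ t x * r 0 t x * r 0 t x * r 1 t x * u 0 t x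
      + 1 / 2 * (A t x - ρ t x * A₁ t x) * r 0 t x * r 0 t x * u 1 t x) ?_ ?_ h0.le hT
      (fun x => ?_)
    case refine_3 =>
      exact (((((((J.Ax t x h0 hT).fun_sub ((J.ρx t x).fun_mul (J.A₁x t x h0 hT))).const_mul
        (1 / 2)).fun_mul (J.rx 0 t x)).fun_mul (J.rx 0 t x)).fun_mul (J.ux 0 t x))).congr_deriv
          (by ring)
    all_goals
      repeat' first
        | assumption
        | exact BddStrip.const _
        | apply DecStrip.add
        | apply DecStrip.sub
        | apply DecStrip.neg
        | apply DecStrip.sq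
        | apply DecStrip.bdd_mul
        | apply BddStrip.add
        | apply BddStrip.neg
        | apply BddStrip.mul
        | apply DecStrip.bddStrip
  rw [← sub_eq_zero, ← integral_sub key.1 (hR.integrable h0.le hT)]
  refine Eq.trans (integral_congr_ae (ae_of_all _ fun x => ?_)) hflux
  dsimp only
  ring

/-- Evolution of the first interaction functional. -/
lemma EulerJet.hasDerivAt_cross_zero (J : EulerJet lam T m M δ ρ A A₁ A₂ r u) {t : ℝ}
    (h0 : 0 < t) (hT : t < T) :
    Integrable (fun x => (-(A t x * r 1 t x ^ 2) - lam * u 0 t x * r 1 t x + ρ t x * u 1 t x ^ 2)) ∧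
    HasDerivAt (fun s => ∫ x, u 0 s x * r 1 s x)
      (∫ x, (-(A t x * r 1 t x ^ 2) - lam * u 0 t x * r 1 t x + ρ t x * u 1 t x ^ 2)) t := by
  have bρ := J.bddρ
  have bA := J.bddA
  have bA₁ := J.bddA₁
  have bA₂ := J.bddA₂
  have dr0 := J.decr 0
  have dr1 := J.decr 1
  have dr2 := J.decr 2
  have dr3 := J.decr 3
  have du0 := J.decu 0
  have du1 := J.decu 1
  have du2 := J.decu 2
  have du3 := J.decu 3
  refine hasDerivAt_integral_of_balance (T := T) (q := fun t x => u 0 t x * r 1 t x)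
    (R := fun t x => -(A t x * r 1 t x ^ 2) - lam * u 0 t x * r 1 t x + ρ t x * u 1 t x ^ 2)
    (Φ := fun t x => u 0 t x * (r 1 t x * u 0 t x + ρ t x * u 1 t x))
    (Φ' := fun t x => u 1 t x * (r 1 t x * u 0 t x + ρ t x * u 1 t x)
      + u 0 t x * (r 2 t x * u 0 t x + 2 * r 1 t x * u 1 t x + ρ t x * u 2 t x))
    ?_ ?_ ?_ ?_ (fun t h0 hT x => ?_) (fun t h0 hT x => ?_) h0 hT
  case refine_5 =>
    exact ((J.u0t t x h0 hT).fun_mul (J.r1t t x h0 hT)).congr_deriv (by ring)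
  case refine_6 =>
    exact ((J.ux 0 t x).fun_mul (((J.rx 1 t x).fun_mul (J.ux 0 t x)).fun_add
      ((J.ρx t x).fun_mul (J.ux 1 t x)))).congr_deriv (by ring)
  all_goals
    repeat' first
      | assumption
      | exact BddStrip.const _
      | apply DecStrip.add
      | apply DecStrip.sub
      | apply DecStrip.neg
      | apply DecStrip.sq
      | apply DecStrip.bdd_mul
      | apply BddStrip.add
      | apply BddStrip.neg
      | apply BddStrip.mul
      | apply DecStrip.bddStrip

/-- Evolution of the second interaction functional. -/
lemma EulerJet.hasDerivAt_cross_one (J : EulerJet lam T m M δ ρ A A₁ A₂ r u) {t : ℝ}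
    (h0 : 0 < t) (hT : t < T) :
    Integrable (fun x => (-(A t x * r 2 t x ^ 2) - lam * u 1 t x * r 2 t x + ρ t x * u 2 t x ^ 2
        + (-(A₁ t x * r 1 t x * r 1 t x * r 2 t x) - u 1 t x * u 1 t x * r 2 t x
          + 2 * r 1 t x * u 1 t x * u 2 t x))) ∧
    HasDerivAt (fun s => ∫ x, u 1 s x * r 2 s x)
      (∫ x, (-(A t x * r 2 t x ^ 2) - lam * u 1 t x * r 2 t x + ρ t x * u 2 t x ^ 2
        + (-(A₁ t x * r 1 t x * r 1 t x * r 2 t x) - u 1 t x * u 1 t x * r 2 t x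
          + 2 * r 1 t x * u 1 t x * u 2 t x))) t := by
  have bρ := J.bddρ
  have bA := J.bddA
  have bA₁ := J.bddA₁
  have bA₂ := J.bddA₂
  have dr0 := J.decr 0
  have dr1 := J.decr 1
  have dr2 := J.decr 2
  have dr3 := J.decr 3
  have du0 := J.decu 0
  have du1 := J.decu 1
  have du2 := J.decu 2
  have du3 := J.decu 3
  refine hasDerivAt_integral_of_balance (T := T) (q := fun t x => u 1 t x * r 2 t x)
    (R := fun t x => -(A t x * r 2 t x ^ 2) - lam * u 1 t x * r 2 t x + ρ t x * u 2 t x ^ 2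
        + (-(A₁ t x * r 1 t x * r 1 t x * r 2 t x) - u 1 t x * u 1 t x * r 2 t x
          + 2 * r 1 t x * u 1 t x * u 2 t x))
    (Φ := fun t x => u 1 t x * (r 2 t x * u 0 t x + 2 * r 1 t x * u 1 t x + ρ t x * u 2 t x))
    (Φ' := fun t x => u 2 t x * (r 2 t x * u 0 t x + 2 * r 1 t x * u 1 t x + ρ t x * u 2 t x)
      + u 1 t x * (r 3 t x * u 0 t x + 3 * r 2 t x * u 1 t x + 3 * r 1 t x * u 2 t x
        + ρ t x * u 3 t x))
    ?_ ?_ ?_ ?_ (fun t h0 hT x => ?_) (fun t h0 hT x => ?_) h0 hT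
  case refine_5 =>
    exact ((J.u1t t x h0 hT).fun_mul (J.r2t t x h0 hT)).congr_deriv (by ring)
  case refine_6 =>
    exact ((J.ux 1 t x).fun_mul ((((J.rx 2 t x).fun_mul (J.ux 0 t x)).fun_add
      (((J.rx 1 t x).const_mul 2).fun_mul (J.ux 1 t x))).fun_add
        ((J.ρx t x).fun_mul (J.ux 2 t x)))).congr_deriv (by ring)
  all_goals
    repeat' first
      | assumption
      | exact BddStrip.const _
      | apply DecStrip.add
      | apply DecStrip.sub
      | apply DecStrip.neg
      | apply DecStrip.sq
      | apply DecStrip.bdd_mul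
      | apply BddStrip.add
      | apply BddStrip.neg
      | apply BddStrip.mul
      | apply DecStrip.bddStrip

/-- Evolution of the unweighted kinetic energy. -/
lemma EulerJet.hasDerivAt_kinetic (J : EulerJet lam T m M δ ρ A A₁ A₂ r u) {t : ℝ}
    (h0 : 0 < t) (hT : t < T) :
    Integrable (fun x => (-(A t x * r 1 t x * u 0 t x) - lam * u 0 t x ^ 2)) ∧
    HasDerivAt (fun s => ∫ x, 1 / 2 * u 0 s x ^ 2)
      (∫ x, (-(A t x * r 1 t x * u 0 t x) - lam * u 0 t x ^ 2)) t := by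
  have bρ := J.bddρ
  have bA := J.bddA
  have bA₁ := J.bddA₁
  have bA₂ := J.bddA₂
  have dr0 := J.decr 0
  have dr1 := J.decr 1
  have dr2 := J.decr 2
  have dr3 := J.decr 3
  have du0 := J.decu 0
  have du1 := J.decu 1
  have du2 := J.decu 2
  have du3 := J.decu 3
  refine hasDerivAt_integral_of_balance (T := T) (q := fun t x => 1 / 2 * u 0 t x ^ 2)
    (R := fun t x => -(A t x * r 1 t x * u 0 t x) - lam * u 0 t x ^ 2)
    (Φ := fun t x => 1 / 3 * u 0 t x * u 0 t x * u 0 t x)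
    (Φ' := fun t x => u 0 t x * u 0 t x * u 1 t x)
    ?_ ?_ ?_ ?_ (fun t h0 hT x => ?_) (fun t h0 hT x => ?_) h0 hT
  case refine_5 =>
    exact (((J.u0t t x h0 hT).fun_pow 2).const_mul (1 / 2)).congr_deriv (by push_cast; ring)
  case refine_6 =>
    exact ((((J.ux 0 t x).const_mul (1 / 3)).fun_mul (J.ux 0 t x)).fun_mul
      (J.ux 0 t x)).congr_deriv (by ring)
  all_goals
    repeat' first
      | assumption
      | exact BddStrip.const _
      | apply DecStrip.add
      | apply DecStrip.sub
      | apply DecStrip.neg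
      | apply DecStrip.sq
      | apply DecStrip.bdd_mul
      | apply BddStrip.add
      | apply BddStrip.neg
      | apply BddStrip.mul
      | apply DecStrip.bddStrip

end Energy

section WeightedDecay

variable {L L' Y Y' V V' D B : ℝ → ℝ} {c C lam T : ℝ}

/-- Time-weighted bounds for a system of differential inequalities: the energy `L` is dissipated at
rate `D`, the higher order energy `Y` at rate `B` up to an error `D Y`. -/
lemma weighted_dissipation (hc : 0 < c) (hC : 0 ≤ C)
    (cL : ContinuousOn L (Ico 0 T)) (cY : ContinuousOn Y (Ico 0 T))
    (cD : ContinuousOn D (Ico 0 T)) (cB : ContinuousOn B (Ico 0 T))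
    (dL : ∀ t, 0 < t → t < T → HasDerivAt L (L' t) t)
    (dY : ∀ t, 0 < t → t < T → HasDerivAt Y (Y' t) t)
    (hL : ∀ t, 0 < t → t < T → L' t ≤ -(c * D t))
    (hY : ∀ t, 0 < t → t < T → Y' t ≤ -(c * B t) + C * (D t * Y t))
    (hYD : ∀ t, 0 < t → t < T → Y t ≤ C * D t)
    (hL0 : ∀ t, 0 ≤ t → t < T → 0 ≤ L t) (hL1 : ∀ t, 0 < t → t < T → 2 * C / c * L t ≤ 1)
    (hY0 : ∀ t, 0 ≤ t → t < T → 0 ≤ Y t) (hD0 : ∀ t, 0 ≤ t → t < T → 0 ≤ D t)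
    (hB0 : ∀ t, 0 ≤ t → t < T → 0 ≤ B t) {t : ℝ} (ht : 0 < t) (htT : t < T) :
    (2 * C / c + 1) * L t + t * Y t + c * (∫ s in (0 : ℝ)..t, (D s + s * B s)) ≤
      (2 * C / c + 1) * L 0 := by
  have hsub : Icc 0 t ⊆ Ico 0 T := fun s hs => ⟨hs.1, hs.2.trans_lt htT⟩
  set K := 2 * C / c with hK
  have hK0 : 0 ≤ K := by positivity
  have hKc : K * c = 2 * C := by rw [hK]; field_simp
  have cW : ContinuousOn (fun s => s * Y s * (1 + K * L s) + (K + 1) * L s) (Icc 0 t) :=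
    ((continuousOn_id.mul (cY.mono hsub)).mul
      (continuousOn_const.add (continuousOn_const.mul (cL.mono hsub)))).add
      (continuousOn_const.mul (cL.mono hsub))
  have cI : ContinuousOn (fun s => D s + s * B s) (Icc 0 t) :=
    (cD.mono hsub).add (continuousOn_id.mul (cB.mono hsub))
  have key := intervalIntegral.sub_le_integral_of_hasDeriv_right_of_le (a := 0) (b := t)
    (g := fun s => s * Y s * (1 + K * L s) + (K + 1) * L s)
    (g' := fun s => (1 * Y s + s * Y' s) * (1 + K * L s) + s * Y s * (K * L' s) + (K + 1) * L' s)
    (φ := fun s => -c * (D s + s * B s)) ht.le cW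
    (fun s hs => by
      have h1 := dY s hs.1 (hs.2.trans htT)
      have h2 := dL s hs.1 (hs.2.trans htT)
      exact ((((hasDerivAt_id' s).fun_mul h1).fun_mul ((h2.const_mul K).const_add 1)).fun_add
        (h2.const_mul (K + 1))).hasDerivWithinAt)
    ((cI.integrableOn_Icc).const_mul (-c))
    (fun s hs => by
      have hs0 := hs.1
      have hsT := hs.2.trans htT
      have a1 := hL s hs0 hsT
      have a2 := hY s hs0 hsT
      have a3 := hYD s hs0 hsT
      have n1 := hL0 s hs0.le hsT
      have n2 := hL1 s hs0 hsT
      have n3 := hY0 s hs0.le hsT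
      have n4 := hD0 s hs0.le hsT
      have n5 := hB0 s hs0.le hsT
      have i1 : (1 + K * L s) * (Y s) ≤ 2 * (C * D s) :=
        mul_le_mul (by linarith) a3 n3 (by norm_num)
      have i2 := mul_le_mul_of_nonneg_left a2
        (mul_nonneg hs0.le (by positivity : 0 ≤ 1 + K * L s))
      have i3 := mul_nonneg (mul_nonneg hs0.le (mul_nonneg hc.le n5)) (mul_nonneg hK0 n1)
      have i4 := mul_le_mul_of_nonneg_right n2
        (mul_nonneg hs0.le (mul_nonneg hC (mul_nonneg n4 n3)))
      have i5 := mul_le_mul_of_nonneg_left a1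
        (by positivity : 0 ≤ s * Y s * K + (K + 1))
      have e1 : s * Y s * (K * c) * D s = s * Y s * (2 * C) * D s := by rw [hKc]
      have e2 : (K * c) * D s = (2 * C) * D s := by rw [hKc]
      linarith only [i1, i2, i3, i4, i5, e1, e2])
  rw [intervalIntegral.integral_const_mul] at key
  have h1 := mul_nonneg (mul_nonneg ht.le (hY0 t ht.le htT)) (mul_nonneg hK0 (hL0 t ht.le htT))
  simp only [zero_mul, zero_add] at key
  linarith only [key, h1]

/-- Algebraic decay of a damped quantity forced by one that decays. -/
lemma weighted_damped_decay (hc : 0 < c) (hC : 0 ≤ C) (hlam : 0 < lam) {N₁ N₂ : ℝ}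
    (cL : ContinuousOn L (Ico 0 T)) (cV : ContinuousOn V (Ico 0 T))
    (dL : ∀ t, 0 < t → t < T → HasDerivAt L (L' t) t)
    (dV : ∀ t, 0 < t → t < T → HasDerivAt V (V' t) t)
    (hL : ∀ t, 0 < t → t < T → L' t ≤ -(c * D t))
    (hV : ∀ t, 0 < t → t < T → V' t ≤ -(lam * V t) + C * Y t)
    (hVD : ∀ t, 0 < t → t < T → V t ≤ C * D t)
    (hL0 : ∀ t, 0 ≤ t → t < T → 0 ≤ L t) (hL1 : ∀ t, 0 ≤ t → t < T → L t ≤ N₁)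
    (hYN : ∀ t, 0 < t → t < T → t * Y t ≤ N₂) (hN₂ : 0 ≤ N₂)
    {t : ℝ} (ht : 0 < t) (htT : t < T) :
    t * V t ≤ C / c * N₁ + C / lam * N₂ := by
  have hsub : Icc 0 t ⊆ Ico 0 T := fun s hs => ⟨hs.1, hs.2.trans_lt htT⟩
  set N := C / c * N₁ + C / lam * N₂ with hN
  have hCc : C / c * c = C := div_mul_cancel₀ _ hc.ne'
  have hCl : C / lam * lam = C := div_mul_cancel₀ _ hlam.ne'
  have hCc0 : 0 ≤ C / c := by positivity
  have hCl0 : 0 ≤ C / lam := by positivity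
  have hanti : AntitoneOn (fun s => (s * V s + C / c * L s - N) * Real.exp (lam * s)) (Icc 0 t) := by
    have hder : ∀ s ∈ Ioo 0 t, HasDerivAt
        (fun s => (s * V s + C / c * L s - N) * Real.exp (lam * s))
        ((1 * V s + s * V' s + C / c * L' s) * Real.exp (lam * s) +
          (s * V s + C / c * L s - N) * (Real.exp (lam * s) * (lam * 1))) s := fun s hs =>
      ((((hasDerivAt_id' s).fun_mul (dV s hs.1 (hs.2.trans htT))).fun_add
        ((dL s hs.1 (hs.2.trans htT)).const_mul (C / c))).sub_const N).fun_mul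
        (((hasDerivAt_id' s).const_mul lam).exp)
    refine antitoneOn_of_deriv_nonpos (convex_Icc 0 t) ?_ ?_ ?_
    · exact (((continuousOn_id.mul (cV.mono hsub)).add
        (continuousOn_const.mul (cL.mono hsub))).sub continuousOn_const).mul
        (Real.continuous_exp.comp (continuous_const.mul continuous_id)).continuousOn
    · rw [interior_Icc]
      exact fun s hs => (hder s hs).differentiableAt.differentiableWithinAt
    · rw [interior_Icc]
      intro s hs
      rw [(hder s hs).deriv]
      have hs0 := hs.1
      have hsT := hs.2.trans htT
      have i1 := mul_le_mul_of_nonneg_left (hL s hs0 hsT) hCc0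
      have i2 := mul_le_mul_of_nonneg_left (hV s hs0 hsT) hs0.le
      have i3 := mul_le_mul_of_nonneg_left (hYN s hs0 hsT) hC
      have i4 := mul_le_mul_of_nonneg_left (hL1 s hs0.le hsT) (mul_nonneg hlam.le hCc0)
      have i5 := hVD s hs0 hsT
      have e1 : C / c * c * D s = C * D s := by rw [hCc]
      have e2 : C / lam * lam * N₂ = C * N₂ := by rw [hCl]
      have e3 : lam * N = lam * (C / c) * N₁ + C / lam * lam * N₂ := by rw [hN]; ring
      have : 1 * V s + s * V' s + C / c * L' s + lam * (s * V s + C / c * L s - N) ≤ 0 := by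
        linarith only [i1, i2, i3, i4, i5, e1, e2, e3]
      calc _ = (1 * V s + s * V' s + C / c * L' s + lam * (s * V s + C / c * L s - N)) *
            Real.exp (lam * s) := by ring
        _ ≤ 0 := mul_nonpos_of_nonpos_of_nonneg this (Real.exp_pos _).le
  have h := hanti ⟨le_rfl, ht.le⟩ ⟨ht.le, le_rfl⟩ ht.le
  have h00 := mul_le_mul_of_nonneg_left (hL1 0 le_rfl (ht.trans htT)) hCc0
  have hN2 := mul_nonneg hCl0 hN₂
  simp only [zero_mul, zero_add, mul_zero, Real.exp_zero, mul_one] at h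
  have h2 : t * V t + C / c * L t - N ≤ 0 := by
    by_contra hcon
    push Not at hcon
    have := mul_pos hcon (Real.exp_pos (lam * t))
    linarith only [this, h, h00, hN2, hN]
  linarith only [h2, mul_nonneg hCc0 (hL0 t ht.le htT)]

end WeightedDecay

section Lyapunov

variable {lam T m M δ κ : ℝ} {ρ A A₁ A₂ : ℝ → ℝ → ℝ} {r u : ℕ → ℝ → ℝ → ℝ}

/-- The weighted `L²` energy of the `k`-th order derivatives. -/
def jetEnergy (A ρ : ℝ → ℝ → ℝ) (r u : ℕ → ℝ → ℝ → ℝ) (k : ℕ) (t : ℝ) : ℝ :=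
  ∫ x, 1 / 2 * (A t x * r k t x ^ 2 + ρ t x * u k t x ^ 2)

/-- The total energy, corrected by interaction terms. -/
def jetLyapunov (κ : ℝ) (A ρ : ℝ → ℝ → ℝ) (r u : ℕ → ℝ → ℝ → ℝ) (t : ℝ) : ℝ :=
  jetEnergy A ρ r u 0 t + jetEnergy A ρ r u 1 t + jetEnergy A ρ r u 2 t +
    κ * ((∫ x, u 0 t x * r 1 t x) + ∫ x, u 1 t x * r 2 t x)

/-- The dissipation rate of the total energy. -/
def jetDissipation (r u : ℕ → ℝ → ℝ → ℝ) (t : ℝ) : ℝ :=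
  ∫ x, (r 1 t x ^ 2 + r 2 t x ^ 2 + u 0 t x ^ 2 + u 1 t x ^ 2 + u 2 t x ^ 2)

/-- The squared `H²` norm. -/
def jetNorm (r u : ℕ → ℝ → ℝ → ℝ) (t : ℝ) : ℝ :=
  ∫ x, (r 0 t x ^ 2 + r 1 t x ^ 2 + r 2 t x ^ 2 + u 0 t x ^ 2 + u 1 t x ^ 2 + u 2 t x ^ 2)

lemma EulerJet.decStrip_energy (J : EulerJet lam T m M δ ρ A A₁ A₂ r u) (k : ℕ) :
    DecStrip T (fun t x => 1 / 2 * (A t x * r k t x ^ 2 + ρ t x * u k t x ^ 2)) :=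
  DecStrip.bdd_mul (BddStrip.const _)
    ((DecStrip.bdd_mul J.bddA (J.decr k).sq).add (DecStrip.bdd_mul J.bddρ (J.decu k).sq))

lemma EulerJet.decStrip_cross (J : EulerJet lam T m M δ ρ A A₁ A₂ r u) (k : ℕ) :
    DecStrip T (fun t x => u k t x * r (k + 1) t x) :=
  DecStrip.bdd_mul (J.decu k).bddStrip (J.decr (k + 1))

lemma EulerJet.decStrip_dissipation (J : EulerJet lam T m M δ ρ A A₁ A₂ r u) :
    DecStrip T (fun t x =>
      r 1 t x ^ 2 + r 2 t x ^ 2 + u 0 t x ^ 2 + u 1 t x ^ 2 + u 2 t x ^ 2) :=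
  ((((J.decr 1).sq.add (J.decr 2).sq).add (J.decu 0).sq).add (J.decu 1).sq).add (J.decu 2).sq

lemma EulerJet.decStrip_norm (J : EulerJet lam T m M δ ρ A A₁ A₂ r u) :
    DecStrip T (fun t x => r 0 t x ^ 2 + r 1 t x ^ 2 + r 2 t x ^ 2
      + u 0 t x ^ 2 + u 1 t x ^ 2 + u 2 t x ^ 2) :=
  (((((J.decr 0).sq.add (J.decr 1).sq).add (J.decr 2).sq).add (J.decu 0).sq).add
    (J.decu 1).sq).add (J.decu 2).sq

lemma EulerJet.continuousOn_lyapunov (J : EulerJet lam T m M δ ρ A A₁ A₂ r u) :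
    ContinuousOn (jetLyapunov κ A ρ r u) (Ico 0 T) :=
  (((J.decStrip_energy 0).continuousOn_integral.add
    (J.decStrip_energy 1).continuousOn_integral).add
    (J.decStrip_energy 2).continuousOn_integral).add
    (continuousOn_const.mul ((J.decStrip_cross 0).continuousOn_integral.add
      (J.decStrip_cross 1).continuousOn_integral))

lemma EulerJet.lyapunov_eq (J : EulerJet lam T m M δ ρ A A₁ A₂ r u) {t : ℝ} (h0 : 0 ≤ t)
    (hT : t < T) : jetLyapunov κ A ρ r u t =
      ∫ x, (1 / 2 * (A t x * r 0 t x ^ 2 + ρ t x * u 0 t x ^ 2)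
        + 1 / 2 * (A t x * r 1 t x ^ 2 + ρ t x * u 1 t x ^ 2)
        + 1 / 2 * (A t x * r 2 t x ^ 2 + ρ t x * u 2 t x ^ 2)
        + κ * (u 0 t x * r 1 t x + u 1 t x * r 2 t x)) := by
  have e0 := (J.decStrip_energy 0).integrable h0 hT
  have e1 := (J.decStrip_energy 1).integrable h0 hT
  have e2 := (J.decStrip_energy 2).integrable h0 hT
  have s0 : Integrable (fun x => u 0 t x * r 1 t x) := (J.decStrip_cross 0).integrable h0 hT
  have s1 : Integrable (fun x => u 1 t x * r 2 t x) := (J.decStrip_cross 1).integrable h0 hT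
  rw [integral_add ((e0.fun_add e1).fun_add e2) ((s0.fun_add s1).const_mul κ),
    integral_add (e0.fun_add e1) e2, integral_add e0 e1, integral_const_mul κ, integral_add s0 s1]
  rfl

lemma EulerJet.lyapunov_bounds (J : EulerJet lam T m M δ ρ A A₁ A₂ r u) (hκ0 : 0 ≤ κ)
    (hκm : 4 * κ ≤ m) (hκM : κ ≤ M) {t : ℝ} (h0 : 0 ≤ t) (hT : t < T) :
    m / 4 * jetNorm r u t ≤ jetLyapunov κ A ρ r u t ∧
      jetLyapunov κ A ρ r u t ≤ M * jetNorm r u t := by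
  rw [J.lyapunov_eq h0 hT]
  have hN := J.decStrip_norm.integrable h0 hT
  have hL : Integrable (fun x => 1 / 2 * (A t x * r 0 t x ^ 2 + ρ t x * u 0 t x ^ 2)
        + 1 / 2 * (A t x * r 1 t x ^ 2 + ρ t x * u 1 t x ^ 2)
        + 1 / 2 * (A t x * r 2 t x ^ 2 + ρ t x * u 2 t x ^ 2)
        + κ * (u 0 t x * r 1 t x + u 1 t x * r 2 t x)) :=
    ((((J.decStrip_energy 0).integrable h0 hT).fun_add
      ((J.decStrip_energy 1).integrable h0 hT)).fun_add
      ((J.decStrip_energy 2).integrable h0 hT)).fun_add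
      ((((J.decStrip_cross 0).integrable h0 hT).fun_add
        ((J.decStrip_cross 1).integrable h0 hT)).const_mul κ)
  rw [jetNorm, ← integral_const_mul, ← integral_const_mul]
  have hlow : ∀ k x, m * r k t x ^ 2 ≤ A t x * r k t x ^ 2 ∧ m * u k t x ^ 2 ≤ ρ t x * u k t x ^ 2 :=
    fun k x => ⟨mul_le_mul_of_nonneg_right (J.le_A t x h0 hT) (sq_nonneg _),
      mul_le_mul_of_nonneg_right (J.le_ρ t x h0 hT) (sq_nonneg _)⟩
  have hup : ∀ k x, A t x * r k t x ^ 2 ≤ M * r k t x ^ 2 ∧ ρ t x * u k t x ^ 2 ≤ M * u k t x ^ 2 :=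
    fun k x => ⟨mul_le_mul_of_nonneg_right (J.A_le t x h0 hT) (sq_nonneg _),
      mul_le_mul_of_nonneg_right (J.ρ_le t x h0 hT) (sq_nonneg _)⟩
  have hκ2 : ∀ y : ℝ, 4 * (κ * y ^ 2) ≤ m * y ^ 2 ∧ κ * y ^ 2 ≤ M * y ^ 2 ∧ 0 ≤ κ * y ^ 2 :=
    fun y => ⟨by rw [← mul_assoc]; exact mul_le_mul_of_nonneg_right hκm (sq_nonneg _),
      mul_le_mul_of_nonneg_right hκM (sq_nonneg _), mul_nonneg hκ0 (sq_nonneg _)⟩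
  constructor
  · refine integral_mono (hN.const_mul _) hL fun x => ?_
    dsimp only
    linarith only [hlow 0 x, hlow 1 x, hlow 2 x, hκ2 (r 0 t x), hκ2 (r 1 t x), hκ2 (r 2 t x),
      hκ2 (u 0 t x), hκ2 (u 1 t x), hκ2 (u 2 t x),
      mul_nonneg hκ0 (sq_nonneg (u 0 t x + r 1 t x)),
      mul_nonneg hκ0 (sq_nonneg (u 1 t x + r 2 t x))]
  · refine integral_mono hL (hN.const_mul _) fun x => ?_
    dsimp only
    linarith only [hup 0 x, hup 1 x, hup 2 x, hκ2 (r 0 t x), hκ2 (r 1 t x), hκ2 (r 2 t x),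
      hκ2 (u 0 t x), hκ2 (u 1 t x), hκ2 (u 2 t x),
      mul_nonneg hκ0 (sq_nonneg (u 0 t x - r 1 t x)),
      mul_nonneg hκ0 (sq_nonneg (u 1 t x - r 2 t x))]

lemma EulerJet.hasDerivAt_energy_one (J : EulerJet lam T m M δ ρ A A₁ A₂ r u) {t : ℝ}
    (h0 : 0 < t) (hT : t < T) :
    Integrable (fun x => (-(lam * ρ t x * u 1 t x ^ 2)
        + (1 / 2 * (A t x - ρ t x * A₁ t x) * u 1 t x * r 1 t x ^ 2
          + (A t x + ρ t x * A₁ t x) * r 1 t x * r 1 t x * u 1 t x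
          - A t x * r 1 t x * (2 * (r 1 t x * u 1 t x))
          - ρ t x * u 1 t x * (u 1 t x * u 1 t x + A₁ t x * r 1 t x * r 1 t x)))) ∧
    HasDerivAt (jetEnergy A ρ r u 1)
      (∫ x, (-(lam * ρ t x * u 1 t x ^ 2)
        + (1 / 2 * (A t x - ρ t x * A₁ t x) * u 1 t x * r 1 t x ^ 2
          + (A t x + ρ t x * A₁ t x) * r 1 t x * r 1 t x * u 1 t x
          - A t x * r 1 t x * (2 * (r 1 t x * u 1 t x))
          - ρ t x * u 1 t x * (u 1 t x * u 1 t x + A₁ t x * r 1 t x * r 1 t x)))) t :=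
  J.hasDerivAt_energy (F := fun t x => 2 * (r 1 t x * u 1 t x))
    (G := fun t x => u 1 t x * u 1 t x + A₁ t x * r 1 t x * r 1 t x)
    (J.decr 1) (J.decr 2) (J.decu 1) (J.decu 2)
    (DecStrip.bdd_mul (BddStrip.const 2) (DecStrip.bdd_mul (J.decr 1).bddStrip (J.decu 1)))
    ((DecStrip.bdd_mul (J.decu 1).bddStrip (J.decu 1)).add
      (DecStrip.bdd_mul (J.bddA₁.mul (J.decr 1).bddStrip) (J.decr 1)))
    (J.rx 1) (J.ux 1) J.r1t J.u1t h0 hT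

lemma EulerJet.hasDerivAt_energy_two (J : EulerJet lam T m M δ ρ A A₁ A₂ r u) {t : ℝ}
    (h0 : 0 < t) (hT : t < T) :
    Integrable (fun x => (-(lam * ρ t x * u 2 t x ^ 2)
        + (1 / 2 * (A t x - ρ t x * A₁ t x) * u 1 t x * r 2 t x ^ 2
          + (A t x + ρ t x * A₁ t x) * r 1 t x * r 2 t x * u 2 t x
          - A t x * r 2 t x * (3 * (r 2 t x * u 1 t x + r 1 t x * u 2 t x))
          - ρ t x * u 2 t x * (3 * (u 1 t x * u 2 t x) + 3 * (A₁ t x * r 1 t x * r 2 t x)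
            + A₂ t x * r 1 t x * r 1 t x * r 1 t x)))) ∧
    HasDerivAt (jetEnergy A ρ r u 2)
      (∫ x, (-(lam * ρ t x * u 2 t x ^ 2)
        + (1 / 2 * (A t x - ρ t x * A₁ t x) * u 1 t x * r 2 t x ^ 2
          + (A t x + ρ t x * A₁ t x) * r 1 t x * r 2 t x * u 2 t x
          - A t x * r 2 t x * (3 * (r 2 t x * u 1 t x + r 1 t x * u 2 t x))
          - ρ t x * u 2 t x * (3 * (u 1 t x * u 2 t x) + 3 * (A₁ t x * r 1 t x * r 2 t x)
            + A₂ t x * r 1 t x * r 1 t x * r 1 t x)))) t :=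
  J.hasDerivAt_energy (F := fun t x => 3 * (r 2 t x * u 1 t x + r 1 t x * u 2 t x))
    (G := fun t x => 3 * (u 1 t x * u 2 t x) + 3 * (A₁ t x * r 1 t x * r 2 t x)
            + A₂ t x * r 1 t x * r 1 t x * r 1 t x)
    (J.decr 2) (J.decr 3) (J.decu 2) (J.decu 3)
    (DecStrip.bdd_mul (BddStrip.const 3) ((DecStrip.bdd_mul (J.decr 2).bddStrip (J.decu 1)).add
      (DecStrip.bdd_mul (J.decr 1).bddStrip (J.decu 2))))
    (((DecStrip.bdd_mul (BddStrip.const 3) (DecStrip.bdd_mul (J.decu 1).bddStrip (J.decu 2))).add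
      (DecStrip.bdd_mul (BddStrip.const 3)
        (DecStrip.bdd_mul (J.bddA₁.mul (J.decr 1).bddStrip) (J.decr 2)))).add
      (DecStrip.bdd_mul ((J.bddA₂.mul (J.decr 1).bddStrip).mul (J.decr 1).bddStrip) (J.decr 1)))
    (J.rx 2) (J.ux 2) J.r2t J.u2t h0 hT

/-- Dissipation of the corrected total energy. -/
lemma EulerJet.exists_hasDerivAt_lyapunov (J : EulerJet lam T m M δ ρ A A₁ A₂ r u) (hm : 0 < m)
    (hm1 : m ≤ 1) (hM : 1 ≤ M) (hlam : m ≤ lam) (hlamM : lam ≤ M) (hδ1 : δ ≤ 1)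
    (hκ : κ * (4 * M ^ 2) = m ^ 3) (hδκ : 20 * M ^ 2 * δ ≤ κ * m / 4) {t : ℝ} (h0 : 0 < t)
    (hT : t < T) : ∃ d, HasDerivAt (jetLyapunov κ A ρ r u) d t ∧
      d ≤ -(κ * m / 4 * jetDissipation r u t) := by
  obtain ⟨i0, d0⟩ := J.hasDerivAt_energy_zero h0 hT
  obtain ⟨i1, d1⟩ := J.hasDerivAt_energy_one h0 hT
  obtain ⟨i2, d2⟩ := J.hasDerivAt_energy_two h0 hT
  obtain ⟨i3, d3⟩ := J.hasDerivAt_cross_zero h0 hT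
  obtain ⟨i4, d4⟩ := J.hasDerivAt_cross_one h0 hT
  refine ⟨_, ((d0.add d1).add d2).add ((d3.add d4).const_mul κ), ?_⟩
  rw [jetDissipation, ← neg_mul, ← integral_const_mul, ← integral_add i3 i4,
    ← integral_const_mul, ← integral_add i0 i1, ← integral_add (i0.fun_add i1) i2,
    ← integral_add ((i0.fun_add i1).fun_add i2) ((i3.fun_add i4).const_mul κ)]
  refine integral_mono (((i0.fun_add i1).fun_add i2).fun_add ((i3.fun_add i4).const_mul κ))
    ((J.decStrip_dissipation.integrable h0.le hT).const_mul _) fun x => ?_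
  exact pointwise_dissipation hm hm1 hM hlam hlamM (J.le_ρ t x h0.le hT) (J.ρ_le t x h0.le hT)
    (J.le_A t x h0.le hT) (J.A_le t x h0.le hT) (J.A₁_le t x h0.le hT) (J.A₂_le t x h0.le hT)
    (J.r0_le t x h0.le hT) (J.r1_le t x h0.le hT) (J.u1_le t x h0.le hT) hδ1 hκ hδκ

end Lyapunov

section Estimates

variable {lam T m M δ κ : ℝ} {ρ A A₁ A₂ : ℝ → ℝ → ℝ} {r u : ℕ → ℝ → ℝ → ℝ}

lemma EulerJet.le_energy_one (J : EulerJet lam T m M δ ρ A A₁ A₂ r u) {t : ℝ} (h0 : 0 ≤ t)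
    (hT : t < T) :
    m / 2 * ((∫ x, r 1 t x ^ 2) + ∫ x, u 1 t x ^ 2) ≤ jetEnergy A ρ r u 1 t := by
  have i1 := (J.decr 1).sq.integrable h0 hT
  have i2 := (J.decu 1).sq.integrable h0 hT
  rw [← integral_add i1 i2, ← integral_const_mul]
  refine integral_mono ((i1.fun_add i2).const_mul _) ((J.decStrip_energy 1).integrable h0 hT)
    fun x => ?_
  have h1 := mul_le_mul_of_nonneg_right (J.le_A t x h0 hT) (sq_nonneg (r 1 t x))
  have h2 := mul_le_mul_of_nonneg_right (J.le_ρ t x h0 hT) (sq_nonneg (u 1 t x))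
  dsimp only
  linarith only [h1, h2]

lemma EulerJet.energy_one_le (J : EulerJet lam T m M δ ρ A A₁ A₂ r u) (hM : 0 ≤ M) {t : ℝ}
    (h0 : 0 ≤ t) (hT : t < T) : jetEnergy A ρ r u 1 t ≤ M * jetDissipation r u t := by
  rw [jetDissipation, ← integral_const_mul]
  refine integral_mono ((J.decStrip_energy 1).integrable h0 hT)
    ((J.decStrip_dissipation.integrable h0 hT).const_mul _) fun x => ?_
  have h1 := mul_le_mul_of_nonneg_right (J.A_le t x h0 hT) (sq_nonneg (r 1 t x))
  have h2 := mul_le_mul_of_nonneg_right (J.ρ_le t x h0 hT) (sq_nonneg (u 1 t x))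
  dsimp only
  linarith only [h1, h2, mul_nonneg hM (sq_nonneg (r 1 t x)), mul_nonneg hM (sq_nonneg (r 2 t x)),
    mul_nonneg hM (sq_nonneg (u 0 t x)), mul_nonneg hM (sq_nonneg (u 1 t x)),
    mul_nonneg hM (sq_nonneg (u 2 t x))]

lemma EulerJet.sq_r_one_le (J : EulerJet lam T m M δ ρ A A₁ A₂ r u) {t : ℝ} (h0 : 0 ≤ t)
    (hT : t < T) (x : ℝ) : r 1 t x ^ 2 ≤ jetDissipation r u t := by
  have i1 := (J.decr 1).sq.integrable h0 hT
  have i2 := (J.decr 2).sq.integrable h0 hT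
  refine ((J.decr 1).sq_le_integral (J.decr 2) h0 hT (J.rx 1 t) x).trans ?_
  rw [← integral_add i1 i2]
  refine integral_mono (i1.fun_add i2) (J.decStrip_dissipation.integrable h0 hT) fun y => ?_
  dsimp only
  linarith only [sq_nonneg (u 0 t y), sq_nonneg (u 1 t y), sq_nonneg (u 2 t y)]

lemma EulerJet.exists_hasDerivAt_energy_one (J : EulerJet lam T m M δ ρ A A₁ A₂ r u) (hm : 0 < m)
    (hM : 1 ≤ M) (hlam : m ≤ lam) (hδ : M * δ ≤ m ^ 2 / 4) {t : ℝ} (h0 : 0 < t) (hT : t < T) :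
    ∃ d, HasDerivAt (jetEnergy A ρ r u 1) d t ∧
      d ≤ -(m ^ 2 / 2 * ∫ x, u 1 t x ^ 2) +
        2 * M ^ 4 / m ^ 3 * (jetDissipation r u t * jetEnergy A ρ r u 1 t) := by
  obtain ⟨i1, d1⟩ := J.hasDerivAt_energy_one h0 hT
  refine ⟨_, d1, ?_⟩
  have ir := (J.decr 1).sq.integrable h0.le hT
  have iu := (J.decu 1).sq.integrable h0.le hT
  have hD0 : 0 ≤ jetDissipation r u t := (sq_nonneg _).trans (J.sq_r_one_le h0.le hT 0)
  have hB0 : 0 ≤ ∫ x, u 1 t x ^ 2 := integral_nonneg fun x => sq_nonneg _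
  have hY := J.le_energy_one h0.le hT
  calc _ ≤ ∫ x, (-(m ^ 2 / 2) * u 1 t x ^ 2 +
          M ^ 4 / m ^ 2 * (jetDissipation r u t * r 1 t x ^ 2)) := by
        refine integral_mono i1
          ((iu.const_mul _).fun_add ((ir.const_mul _).const_mul _)) fun x => ?_
        refine (pointwise_dissipation_first hm hM hlam (J.le_ρ t x h0.le hT) (J.ρ_le t x h0.le hT)
          (J.le_A t x h0.le hT) (J.A_le t x h0.le hT) (J.A₁_le t x h0.le hT)
          (J.u1_le t x h0.le hT) hδ).trans ?_
        have := J.sq_r_one_le h0.le hT x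
        gcongr
    _ = -(m ^ 2 / 2 * ∫ x, u 1 t x ^ 2) +
          M ^ 4 / m ^ 2 * (jetDissipation r u t * ∫ x, r 1 t x ^ 2) := by
        rw [integral_add (iu.const_mul _) ((ir.const_mul _).const_mul _), integral_const_mul,
          integral_const_mul, integral_const_mul, neg_mul]
    _ ≤ -(m ^ 2 / 2 * ∫ x, u 1 t x ^ 2) +
          M ^ 4 / m ^ 2 * (jetDissipation r u t * (2 / m * jetEnergy A ρ r u 1 t)) := by
        have : ∫ x, r 1 t x ^ 2 ≤ 2 / m * jetEnergy A ρ r u 1 t := by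
          rw [div_mul_eq_mul_div, le_div_iff₀ hm]
          linarith only [hY, mul_nonneg hm.le hB0]
        gcongr
    _ = _ := by field_simp

lemma EulerJet.exists_hasDerivAt_kinetic (J : EulerJet lam T m M δ ρ A A₁ A₂ r u) (hm : 0 < m)
    (hlam : m ≤ lam) {t : ℝ} (h0 : 0 < t) (hT : t < T) :
    ∃ d, HasDerivAt (fun s => ∫ x, 1 / 2 * u 0 s x ^ 2) d t ∧
      d ≤ -(lam * ∫ x, 1 / 2 * u 0 t x ^ 2) + M ^ 2 / m ^ 2 * jetEnergy A ρ r u 1 t := by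
  obtain ⟨i0, d0⟩ := J.hasDerivAt_kinetic h0 hT
  refine ⟨_, d0, ?_⟩
  have iu := ((J.decu 0).sq.integrable h0.le hT).const_mul (1 / 2)
  have ie := (J.decStrip_energy 1).integrable h0.le hT
  rw [jetEnergy, ← neg_mul, ← integral_const_mul (-lam), ← integral_const_mul (M ^ 2 / m ^ 2),
    ← integral_add (iu.const_mul _) (ie.const_mul _)]
  refine integral_mono i0 ((iu.const_mul _).fun_add (ie.const_mul _)) fun x => ?_
  have hA := J.le_A t x h0.le hT
  have hAM := J.A_le t x h0.le hT
  have hρ := J.le_ρ t x h0.le hT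
  have h1 : A t x ^ 2 * r 1 t x ^ 2 ≤ M ^ 2 * r 1 t x ^ 2 := by
    gcongr; exact hm.le.trans hA
  have h2 : M ^ 2 / m ^ 2 * (m * r 1 t x ^ 2) ≤
      M ^ 2 / m ^ 2 * (A t x * r 1 t x ^ 2 + ρ t x * u 1 t x ^ 2) := by
    have h3 := mul_nonneg (hm.le.trans hρ) (sq_nonneg (u 1 t x))
    have h4 := mul_le_mul_of_nonneg_right hA (sq_nonneg (r 1 t x))
    gcongr
    linarith only [h3, h4]
  have e : M ^ 2 / m ^ 2 * (m * r 1 t x ^ 2) = M ^ 2 * r 1 t x ^ 2 / m := by field_simp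
  have h5 : -(2 * (A t x * r 1 t x * u 0 t x)) ≤ m * u 0 t x ^ 2 + M ^ 2 * r 1 t x ^ 2 / m := by
    rw [← sub_le_iff_le_add', le_div_iff₀ hm]
    linarith only [sq_nonneg (m * u 0 t x + A t x * r 1 t x), h1]
  have h6 := mul_le_mul_of_nonneg_right hlam (sq_nonneg (u 0 t x))
  dsimp only
  linarith only [h2, e, h5, h6]

/-- A priori estimate for jets of solutions to the damped Euler system. -/
lemma EulerJet.a_priori_estimate (J : EulerJet lam T m M δ ρ A A₁ A₂ r u) {c C G : ℝ} (hm : 0 < m)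
    (hm1 : m ≤ 1) (hM : 1 ≤ M) (hlam : m ≤ lam) (hlamM : lam ≤ M) (hδ1 : δ ≤ 1)
    (hκ : κ * (4 * M ^ 2) = m ^ 3) (hδκ : 20 * M ^ 2 * δ ≤ κ * m / 4)
    (hδ : M * δ ≤ m ^ 2 / 4) (hc : c = κ * m / 4) (hC : C = 2 * M ^ 4 / m ^ 3)
    (hG : G = 2 * C / c + 1)
    (hsmall : ∀ t, 0 < t → t < T → 2 * C / c * (M * jetNorm r u t) ≤ 1) {t : ℝ} (h0 : 0 < t)
    (hT : t < T) :
    jetNorm r u t + t * (∫ x, u 0 t x ^ 2) + t * ((∫ x, r 1 t x ^ 2) + ∫ x, u 1 t x ^ 2) +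
      (∫ τ in (0 : ℝ)..t, (jetDissipation r u τ + τ * ∫ x, u 1 τ x ^ 2)) ≤
      (4 / m + 2 * (C / c + C / lam * G) + 2 / m * G + G / c) * M * jetNorm r u 0 := by
  have hlam0 : 0 < lam := hm.trans_le hlam
  have hM0 : 0 < M := by linarith
  have hκ0 : 0 < κ := by
    by_contra hcon
    have := pow_pos hm 3
    have := mul_nonpos_of_nonpos_of_nonneg (not_lt.1 hcon) (by positivity : 0 ≤ 4 * M ^ 2)
    linarith
  have hκ4 : 4 * κ ≤ m ^ 3 := by
    have : 1 ≤ M ^ 2 := one_le_pow₀ hM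
    nlinarith
  have hm3 : m ^ 3 ≤ m := pow_le_of_le_one hm.le hm1 (by norm_num)
  have hm32 : m ^ 3 ≤ m ^ 2 := pow_le_pow_of_le_one hm.le hm1 (by norm_num)
  have hc0 : 0 < c := by rw [hc]; positivity
  have hC0 : 0 ≤ C := by rw [hC]; positivity
  have hm3' : m ^ 3 ≤ 1 := hm3.trans hm1
  have hM4 : M ≤ M ^ 4 := le_self_pow₀ hM (by norm_num)
  have hMC : M ≤ C := by
    rw [hC, le_div_iff₀ (pow_pos hm 3)]
    linarith [mul_le_mul_of_nonneg_left hm3' hM0.le, pow_pos hM0 4]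
  have hMC2 : M ^ 2 / m ^ 2 ≤ C := by
    rw [hC]
    have : M ^ 2 ≤ M ^ 4 := pow_le_pow_right₀ hM (by norm_num)
    gcongr
    linarith [pow_pos hM0 4]
  have hcm : c ≤ m ^ 2 / 2 := by
    rw [hc]
    nlinarith
  have hL := fun t h0 hT => J.lyapunov_bounds (κ := κ) (t := t) hκ0.le (hκ4.trans hm3)
    (by linarith) h0 hT
  have hN0 : ∀ t, 0 ≤ jetNorm r u t := fun t => integral_nonneg fun x => by positivity
  have hD0 : ∀ t, 0 ≤ jetDissipation r u t := fun t => integral_nonneg fun x => by positivity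
  have hB0 : ∀ t, 0 ≤ ∫ x, u 1 t x ^ 2 := fun t => integral_nonneg fun x => by positivity
  have hA0 : ∀ t, 0 ≤ ∫ x, r 1 t x ^ 2 := fun t => integral_nonneg fun x => by positivity
  have hY0 : ∀ t, 0 ≤ t → t < T → 0 ≤ jetEnergy A ρ r u 1 t := fun t h0 hT =>
    (mul_nonneg (by positivity) (add_nonneg (hA0 t) (hB0 t))).trans (J.le_energy_one h0 hT)
  have hL0 : ∀ t, 0 ≤ t → t < T → 0 ≤ jetLyapunov κ A ρ r u t := fun t h0 hT =>
    (mul_nonneg (by positivity) (hN0 t)).trans (hL t h0 hT).1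
  choose! L' dL hL' using fun t h0 hT =>
    J.exists_hasDerivAt_lyapunov hm hm1 hM hlam hlamM hδ1 hκ hδκ (t := t) h0 hT
  choose! Y' dY hY' using fun t h0 hT =>
    J.exists_hasDerivAt_energy_one hm hM hlam hδ (t := t) h0 hT
  choose! V' dV hV' using fun t h0 hT => J.exists_hasDerivAt_kinetic hm hlam (t := t) h0 hT
  have hLc : ∀ t, 0 < t → t < T → L' t ≤ -(c * jetDissipation r u t) := by rwa [hc]
  have cL := J.continuousOn_lyapunov (κ := κ)
  have cY : ContinuousOn (jetEnergy A ρ r u 1) (Ico 0 T) :=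
    (J.decStrip_energy 1).continuousOn_integral
  have cD : ContinuousOn (jetDissipation r u) (Ico 0 T) :=
    J.decStrip_dissipation.continuousOn_integral
  have main : ∀ t, 0 < t → t < T → G * jetLyapunov κ A ρ r u t + t * jetEnergy A ρ r u 1 t +
      c * (∫ s in (0 : ℝ)..t, (jetDissipation r u s + s * ∫ x, u 1 s x ^ 2)) ≤
      G * jetLyapunov κ A ρ r u 0 := fun t h0 hT => by
    rw [hG]
    refine weighted_dissipation hc0 hC0 cL cY cD (J.decu 1).sq.continuousOn_integral dL dY hLc
      (fun t h0 hT => ?_) (fun t h0 hT => ?_) hL0 (fun t h0 hT => ?_) hY0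
      (fun t _ _ => hD0 t) (fun t _ _ => hB0 t) h0 hT
    · rw [hC]
      linarith only [hY' t h0 hT, mul_le_mul_of_nonneg_right hcm (hB0 t)]
    · exact (J.energy_one_le hM0.le h0.le hT).trans (mul_le_mul_of_nonneg_right hMC (hD0 t))
    · exact (mul_le_mul_of_nonneg_left (hL t h0.le hT).2 (by positivity)).trans (hsmall t h0 hT)
  have hG1 : 1 ≤ G := by
    rw [hG]
    linarith [show 0 ≤ 2 * C / c by positivity]
  have hI0 : ∀ t, 0 < t →
      0 ≤ ∫ s in (0 : ℝ)..t, (jetDissipation r u s + s * ∫ x, u 1 s x ^ 2) := fun t h0 =>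
    intervalIntegral.integral_nonneg h0.le fun s hs =>
      add_nonneg (hD0 s) (mul_nonneg hs.1 (hB0 s))
  have hL00 := hL0 0 le_rfl (h0.trans hT)
  have hLL : ∀ t, 0 ≤ t → t < T → jetLyapunov κ A ρ r u t ≤ jetLyapunov κ A ρ r u 0 := by
    intro t h0 hT
    rcases h0.eq_or_lt with rfl | h0
    · exact le_rfl
    · refine le_of_mul_le_mul_left ?_ (zero_lt_one.trans_le hG1)
      linarith only [main t h0 hT, mul_nonneg hc0.le (hI0 t h0), mul_nonneg h0.le (hY0 t h0.le hT)]
  have hYL : ∀ t, 0 < t → t < T → t * jetEnergy A ρ r u 1 t ≤ G * jetLyapunov κ A ρ r u 0 :=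
    fun t h0 hT => by
      linarith only [main t h0 hT, mul_nonneg hc0.le (hI0 t h0),
        mul_nonneg (zero_le_one.trans hG1) (hL0 t h0.le hT)]
  have hV := weighted_damped_decay hc0 hC0 hlam0 cL
    (DecStrip.bdd_mul (BddStrip.const (1 / 2)) (J.decu 0).sq).continuousOn_integral dL dV hLc
    (fun t h0 hT => by
      linarith only [hV' t h0 hT, mul_le_mul_of_nonneg_right hMC2 (hY0 t h0.le hT)])
    (fun t h0 hT => by
      refine le_trans ?_ (mul_le_mul_of_nonneg_right (hM.trans hMC) (hD0 t))
      rw [one_mul]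
      refine integral_mono (((J.decu 0).sq.integrable h0.le hT).const_mul _)
        (J.decStrip_dissipation.integrable h0.le hT) fun x => ?_
      dsimp only
      linarith only [sq_nonneg (r 1 t x), sq_nonneg (r 2 t x), sq_nonneg (u 0 t x),
        sq_nonneg (u 1 t x), sq_nonneg (u 2 t x)])
    hL0 hLL hYL (mul_nonneg (zero_le_one.trans hG1) hL00) h0 hT
  rw [integral_const_mul] at hV
  set L0 := jetLyapunov κ A ρ r u 0 with hL0def
  have f1 : jetNorm r u t ≤ 4 / m * L0 := by
    rw [div_mul_eq_mul_div, le_div_iff₀ hm]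
    linarith only [(hL t h0.le hT).1, hLL t h0.le hT]
  have f2 : t * ((∫ x, r 1 t x ^ 2) + ∫ x, u 1 t x ^ 2) ≤ 2 / m * (G * L0) := by
    rw [div_mul_eq_mul_div, le_div_iff₀ hm]
    linarith only [mul_le_mul_of_nonneg_left (J.le_energy_one h0.le hT) h0.le, hYL t h0 hT]
  have f3 : (∫ s in (0 : ℝ)..t, (jetDissipation r u s + s * ∫ x, u 1 s x ^ 2)) ≤ G / c * L0 := by
    rw [div_mul_eq_mul_div, le_div_iff₀ hc0]
    linarith only [main t h0 hT, mul_nonneg h0.le (hY0 t h0.le hT),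
        mul_nonneg (zero_le_one.trans hG1) (hL0 t h0.le hT)]
  calc _ ≤ (4 / m + 2 * (C / c + C / lam * G) + 2 / m * G + G / c) * L0 := by
        linarith only [f1, f2, f3, hV]
    _ ≤ _ := by
        rw [mul_assoc _ M]
        have := (hL 0 le_rfl (h0.trans hT)).2
        gcongr

end Estimates

/-- The enthalpy coefficient `a(s) = P'(s) / s` and its first two derivatives on a neighbourhood of
the equilibrium. -/
lemma exists_enthalpy_coefficients {P : ℝ → ℝ} (hP : ContDiffOn ℝ (⊤ : ℕ∞) P (Ioi 0))
    (hP' : ∀ s : ℝ, 0 < s → 0 < deriv P s) {lam ρbar : ℝ} (hlam : 0 < lam) (hρbar : 0 < ρbar) :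
    ∃ (a a₁ a₂ : ℝ → ℝ) (m M : ℝ), 0 < m ∧ m ≤ 1 ∧ m ≤ lam ∧ m ≤ ρbar / 2 ∧ 1 ≤ M ∧ lam ≤ M ∧
      3 * ρbar / 2 ≤ M ∧ (∀ s, 0 < s → HasDerivAt P (s * a s) s) ∧
      (∀ s, 0 < s → HasDerivAt a (a₁ s) s) ∧ (∀ s, 0 < s → HasDerivAt a₁ (a₂ s) s) ∧
      ContinuousOn a₂ (Ioi 0) ∧ ∀ s ∈ Icc (ρbar / 2) (3 * ρbar / 2),
        m ≤ a s ∧ |a s| ≤ M ∧ |a₁ s| ≤ M ∧ |a₂ s| ≤ M := by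
  have hd : ∀ {f : ℝ → ℝ}, ContDiffOn ℝ (⊤ : ℕ∞) f (Ioi 0) → ∀ s, 0 < s →
      HasDerivAt f (deriv f s) s := fun hf s hs =>
    ((hf.differentiableOn (by simp)).differentiableAt (isOpen_Ioi.mem_nhds hs)).hasDerivAt
  have hsm : ∀ {f : ℝ → ℝ}, ContDiffOn ℝ (⊤ : ℕ∞) f (Ioi 0) →
      ContDiffOn ℝ (⊤ : ℕ∞) (deriv f) (Ioi 0) := fun hf =>
    hf.deriv_of_isOpen isOpen_Ioi (by simp)
  set a : ℝ → ℝ := fun s => deriv P s / s with ha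
  have sa : ContDiffOn ℝ (⊤ : ℕ∞) a (Ioi 0) :=
    (hsm hP).div contDiffOn_id fun s hs => (ne_of_gt hs : s ≠ 0)
  have hpos : ∀ s ∈ Icc (ρbar / 2) (3 * ρbar / 2), 0 < s := fun s hs => by
    linarith [hs.1]
  have hbdd : ∀ {f : ℝ → ℝ}, ContDiffOn ℝ (⊤ : ℕ∞) f (Ioi 0) →
      ∃ B, ∀ s ∈ Icc (ρbar / 2) (3 * ρbar / 2), |f s| ≤ B := fun hf =>
    isCompact_Icc.exists_bound_of_continuousOn (hf.continuousOn.mono hpos)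
  obtain ⟨B₀, hB₀⟩ := hbdd sa
  obtain ⟨B₁, hB₁⟩ := hbdd (hsm sa)
  obtain ⟨B₂, hB₂⟩ := hbdd (hsm (hsm sa))
  obtain ⟨s₀, hs₀, hmin⟩ := isCompact_Icc.exists_isMinOn
    (nonempty_Icc.2 (by linarith : ρbar / 2 ≤ 3 * ρbar / 2)) (sa.continuousOn.mono hpos)
  have ha0 : 0 < a s₀ := div_pos (hP' s₀ (hpos s₀ hs₀)) (hpos s₀ hs₀)
  refine ⟨a, deriv a, deriv (deriv a), min (min 1 lam) (min (ρbar / 2) (a s₀)),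
    1 + lam + 3 * ρbar / 2 + |B₀| + |B₁| + |B₂|, by positivity,
    (min_le_left _ _).trans (min_le_left _ _), (min_le_left _ _).trans (min_le_right _ _),
    (min_le_right _ _).trans (min_le_left _ _), ?_, ?_, ?_, fun s hs => ?_, hd sa, hd (hsm sa),
    (hsm (hsm sa)).continuousOn, fun s hs => ⟨?_, ?_, ?_, ?_⟩⟩
  rotate_left 3
  · refine (hd hP s hs).congr_deriv ?_
    rw [ha]
    field_simp
  · exact ((min_le_right _ _).trans (min_le_right _ _)).trans (hmin hs)
  · refine (hB₀ s hs).trans ?_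
    linarith [le_abs_self B₀, abs_nonneg B₁, abs_nonneg B₂]
  · refine (hB₁ s hs).trans ?_
    linarith [le_abs_self B₁, abs_nonneg B₀, abs_nonneg B₂]
  · refine (hB₂ s hs).trans ?_
    linarith [le_abs_self B₂, abs_nonneg B₀, abs_nonneg B₁]
  all_goals linarith [abs_nonneg B₀, abs_nonneg B₁, abs_nonneg B₂]

section Assembly

variable {P : ℝ → ℝ} {lam ρbar T : ℝ} {ρ u : ℝ → ℝ → ℝ}

lemma IsEulerSolution.sqH2pair_eq (h : IsEulerSolution P lam ρbar T ρ u) {t : ℝ} (h0 : 0 ≤ t)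
    (hT : t < T) : sqH2pair (fun x => ρ t x - ρbar) (u t) =
      jetNorm (fun k t => iteratedDeriv k (fun y => ρ t y - ρbar))
        (fun k t => iteratedDeriv k (u t)) t := by
  have ir := fun k => (h.decStrip_rho k).sq.integrable h0 hT
  have iu := fun k => (h.decStrip_u k).sq.integrable h0 hT
  rw [jetNorm, integral_add (((((ir 0).fun_add (ir 1)).fun_add (ir 2)).fun_add (iu 0)).fun_add
      (iu 1)) (iu 2),
    integral_add ((((ir 0).fun_add (ir 1)).fun_add (ir 2)).fun_add (iu 0)) (iu 1),
    integral_add (((ir 0).fun_add (ir 1)).fun_add (ir 2)) (iu 0),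
    integral_add ((ir 0).fun_add (ir 1)) (ir 2), integral_add (ir 0) (ir 1)]
  simp only [sqH2pair, sqH2, sqH1, sqL2, iteratedDeriv_succ, iteratedDeriv_zero]
  ring

lemma IsEulerSolution.dissipation_eq (h : IsEulerSolution P lam ρbar T ρ u) {t : ℝ} (h0 : 0 ≤ t)
    (hT : t < T) : sqH1 (deriv fun x => ρ t x - ρbar) + sqH2 (u t) =
      jetDissipation (fun k t => iteratedDeriv k (fun y => ρ t y - ρbar))
        (fun k t => iteratedDeriv k (u t)) t := by
  have ir := fun k => (h.decStrip_rho k).sq.integrable h0 hT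
  have iu := fun k => (h.decStrip_u k).sq.integrable h0 hT
  rw [jetDissipation, integral_add ((((ir 1).fun_add (ir 2)).fun_add (iu 0)).fun_add (iu 1)) (iu 2),
    integral_add (((ir 1).fun_add (ir 2)).fun_add (iu 0)) (iu 1),
    integral_add ((ir 1).fun_add (ir 2)) (iu 0), integral_add (ir 1) (ir 2)]
  simp only [sqH2, sqH1, sqL2, iteratedDeriv_succ, iteratedDeriv_zero]
  ring

lemma IsEulerSolution.Xfun_eq (h : IsEulerSolution P lam ρbar T ρ u) {t : ℝ} (h0 : 0 ≤ t)
    (hT : t < T) : ∀ r v : ℕ → ℝ → ℝ → ℝ,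
      r = (fun k t => iteratedDeriv k (fun y => ρ t y - ρbar)) →
      v = (fun k t => iteratedDeriv k (u t)) → Xfun ρbar ρ u t =
      jetNorm r v t + t * (∫ x, v 0 t x ^ 2) + t * ((∫ x, r 1 t x ^ 2) + ∫ x, v 1 t x ^ 2) +
        ∫ τ in (0 : ℝ)..t, (jetDissipation r v τ + τ * ∫ x, v 1 τ x ^ 2) := by
  rintro r v rfl rfl
  rw [Xfun, h.sqH2pair_eq h0 hT]
  simp only [sqL2, iteratedDeriv_one, iteratedDeriv_zero]
  congr 1
  refine intervalIntegral.integral_congr fun s hs => ?_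
  rw [uIcc_of_le h0] at hs
  rw [h.dissipation_eq hs.1 (hs.2.trans_lt hT)]

/-- Pointwise smallness of low order derivatives from smallness in `H²`. -/
lemma IsEulerSolution.abs_le_of_sqrt_le (h : IsEulerSolution P lam ρbar T ρ u) {ε : ℝ}
    (hsm : ∀ t : ℝ, 0 < t → t < T →
      Real.sqrt (sqH2pair (fun x => ρ t x - ρbar) (u t)) ≤ ε) {t : ℝ} (h0 : 0 ≤ t) (hT : t < T)
    (x : ℝ) : |ρ t x - ρbar| ≤ ε ∧ |deriv (fun y => ρ t y - ρbar) x| ≤ ε ∧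
      |deriv (u t) x| ≤ ε := by
  have sr := contDiff_slice_iteratedDeriv (f := fun t x => ρ t x - ρbar) h.contDiff_perturbation
  have su := contDiff_slice_iteratedDeriv h.smooth_u
  have rx : ∀ k t x, HasDerivAt (iteratedDeriv k (fun y => ρ t y - ρbar))
      (iteratedDeriv (k + 1) (fun y => ρ t y - ρbar) x) x := fun k t x => by
    rw [iteratedDeriv_succ]
    exact hasDerivAt_slice_snd
      (f := fun t => iteratedDeriv k (fun y => ρ t y - ρbar)) (sr k) t x
  have ux : ∀ k t x, HasDerivAt (iteratedDeriv k (u t)) (iteratedDeriv (k + 1) (u t) x) x :=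
    fun k t x => by
      rw [iteratedDeriv_succ]
      exact hasDerivAt_slice_snd (f := fun t => iteratedDeriv k (u t)) (su k) t x
  have extend : ∀ {f : ℝ → ℝ → ℝ}, ContDiff ℝ (⊤ : ℕ∞) (fun p : ℝ × ℝ => f p.1 p.2) →
      (∀ t, 0 < t → t < T → f t x ^ 2 ≤ sqH2pair (fun x => ρ t x - ρbar) (u t)) →
      |f t x| ≤ ε := by
    intro f hf hle
    have hpos : ∀ t, 0 < t → t < T → |f t x| ≤ ε := fun t h0 hT => by
      rw [← Real.sqrt_sq_eq_abs]
      exact (Real.sqrt_le_sqrt (hle t h0 hT)).trans (hsm t h0 hT)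
    rcases h0.eq_or_lt with rfl | h0
    · have hc : Continuous fun t => |f t x| :=
        (hf.continuous.comp (continuous_id.prodMk continuous_const)).abs
      refine le_of_tendsto (hc.continuousWithinAt (s := Ioi 0) (x := 0)) ?_
      filter_upwards [Ioo_mem_nhdsGT hT] with s hs
      exact hpos s hs.1 hs.2
    · exact hpos t h0 hT
  have hnn : ∀ (k : ℕ) (t : ℝ), 0 ≤ ∫ x, iteratedDeriv k (fun y => ρ t y - ρbar) x ^ 2 :=
    fun k t => integral_nonneg fun x => sq_nonneg _
  have unn : ∀ (k : ℕ) (t : ℝ), 0 ≤ ∫ x, iteratedDeriv k (u t) x ^ 2 :=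
    fun k t => integral_nonneg fun x => sq_nonneg _
  have split : ∀ t, sqH2pair (fun x => ρ t x - ρbar) (u t) =
      (∫ x, iteratedDeriv 0 (fun y => ρ t y - ρbar) x ^ 2)
      + (∫ x, iteratedDeriv 1 (fun y => ρ t y - ρbar) x ^ 2)
      + (∫ x, iteratedDeriv 2 (fun y => ρ t y - ρbar) x ^ 2)
      + ((∫ x, iteratedDeriv 0 (u t) x ^ 2) + (∫ x, iteratedDeriv 1 (u t) x ^ 2)
      + ∫ x, iteratedDeriv 2 (u t) x ^ 2) := fun t => by
    simp only [sqH2pair, sqH2, sqH1, sqL2, iteratedDeriv_succ, iteratedDeriv_zero]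
  refine ⟨?_, ?_, ?_⟩
  · have := extend (sr 0) fun t h0 hT =>
      ((h.decStrip_rho 0).sq_le_integral (h.decStrip_rho 1) h0.le hT (rx 0 t) x).trans <| by
        rw [split]
        linarith only [hnn 2 t, unn 0 t, unn 1 t, unn 2 t]
    simpa only [iteratedDeriv_zero] using this
  · have := extend (sr 1) fun t h0 hT =>
      ((h.decStrip_rho 1).sq_le_integral (h.decStrip_rho 2) h0.le hT (rx 1 t) x).trans <| by
        rw [split]
        linarith only [hnn 0 t, unn 0 t, unn 1 t, unn 2 t]
    simpa only [iteratedDeriv_one] using this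
  · have := extend (su 1) fun t h0 hT =>
      ((h.decStrip_u 1).sq_le_integral (h.decStrip_u 2) h0.le hT (ux 1 t) x).trans <| by
        rw [split]
        linarith only [hnn 0 t, hnn 1 t, hnn 2 t, unn 0 t]
    simpa only [iteratedDeriv_one] using this

end Assembly

/-- **Lemma 6.1.** A priori estimates for the damped compressible Euler
system: there are `ε₁ > 0`, `C₀ > 0` (independent of `T` and of the data) such that any
classical solution on `ℝ × [0,T)` satisfying the smallness condition
`sup_{0<t<T} ‖(ρ−ρ̄,u)(t)‖_{H²} ≤ ε₁` satisfies `X(t) ≤ C₀‖(ρ₀−ρ̄,u₀)‖²_{H²}`. -/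
theorem euler_a_priori_estimates
    (P : ℝ → ℝ) (hP : ContDiffOn ℝ (⊤ : ℕ∞) P (Set.Ioi 0))
    (hP' : ∀ s : ℝ, 0 < s → 0 < deriv P s)
    (lam : ℝ) (hlam : 0 < lam) (ρbar : ℝ) (hρbar : 0 < ρbar) :
    ∃ ε₁ : ℝ, 0 < ε₁ ∧ ∃ C₀ : ℝ, 0 < C₀ ∧
      ∀ T : ℝ, 0 < T →
        ∀ ρ u : ℝ → ℝ → ℝ, IsEulerSolution P lam ρbar T ρ u →
          (∀ t : ℝ, 0 < t → t < T →
            Real.sqrt (sqH2pair (fun x => ρ t x - ρbar) (u t)) ≤ ε₁) →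
          ∀ t : ℝ, 0 < t → t < T →
            Xfun ρbar ρ u t ≤ C₀ * sqH2pair (fun x => ρ 0 x - ρbar) (u 0) := by
  obtain ⟨a, a₁, a₂, m, M, hm, hm1, hmlam, hmρ, hM, hlamM, hρM, hPa, ha, ha₁, hca₂, hbd⟩ :=
    exists_enthalpy_coefficients hP hP' hlam hρbar
  have hM0 : 0 < M := by linarith
  obtain ⟨κ, hκ⟩ : ∃ κ, κ = m ^ 3 / (4 * M ^ 2) := ⟨_, rfl⟩
  obtain ⟨c, hc⟩ : ∃ c, c = κ * m / 4 := ⟨_, rfl⟩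
  obtain ⟨C, hC⟩ : ∃ C, C = 2 * M ^ 4 / m ^ 3 := ⟨_, rfl⟩
  obtain ⟨G, hG⟩ : ∃ G, G = 2 * C / c + 1 := ⟨_, rfl⟩
  have hκ0 : 0 < κ := by rw [hκ]; positivity
  have hc0 : 0 < c := by rw [hc]; positivity
  have hC0 : 0 < C := by rw [hC]; positivity
  have hG0 : 0 < G := by rw [hG]; positivity
  have hκ' : κ * (4 * M ^ 2) = m ^ 3 := by rw [hκ]; field_simp
  obtain ⟨ε, hε0, hε1, hερ, hεκ, hεM, hεC⟩ : ∃ ε : ℝ, 0 < ε ∧ ε ≤ 1 ∧ ε ≤ ρbar / 2 ∧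
      20 * M ^ 2 * ε ≤ κ * m / 4 ∧ M * ε ≤ m ^ 2 / 4 ∧ 2 * C / c * (M * ε) ≤ 1 := by
    have hsmall : ∀ b : ℝ, ∀ B : ℝ, 0 < B → ∀ᶠ ε in 𝓝[>] (0 : ℝ), b * ε < B := fun b B hB => by
      have : Tendsto (fun ε : ℝ => b * ε) (𝓝 0) (𝓝 (b * 0)) := tendsto_id.const_mul b
      rw [mul_zero] at this
      exact (this.mono_left nhdsWithin_le_nhds).eventually_lt_const hB
    obtain ⟨ε, h0, h1, h2, h3, h4, h5⟩ := ((eventually_mem_nhdsWithin (s := Ioi (0 : ℝ))).and <|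
      (hsmall 1 1 one_pos).and <| (hsmall 1 (ρbar / 2) (by positivity)).and <|
      (hsmall (20 * M ^ 2) (κ * m / 4) (by positivity)).and <|
      (hsmall M (m ^ 2 / 4) (by positivity)).and (hsmall (2 * C / c * M) 1 one_pos)).exists
    rw [one_mul] at h1 h2
    rw [mul_assoc] at h5
    exact ⟨ε, h0, h1.le, h2.le, h3.le, h4.le, h5.le⟩
  refine ⟨ε, hε0, (4 / m + 2 * (C / c + C / lam * G) + 2 / m * G + G / c) * M, by positivity,
    fun T hT ρ u h hsm t h0 htT => ?_⟩
  have hpt := fun t x h0 hT => h.abs_le_of_sqrt_le hsm (t := t) h0 hT x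
  have J := h.eulerJet (half_pos hρbar) hmρ hρM hPa ha ha₁ hca₂ (fun s hs => (hbd s hs).1)
    (fun s hs => (hbd s hs).2.1) (fun s hs => (hbd s hs).2.2.1) (fun s hs => (hbd s hs).2.2.2)
    (fun t x h0 hT => by
      have := abs_le.1 ((hpt t x h0 hT).1.trans hερ)
      constructor <;> linarith [this.1, this.2])
    (fun t x h0 hT => (hpt t x h0 hT).1) (fun t x h0 hT => (hpt t x h0 hT).2.1)
    (fun t x h0 hT => (hpt t x h0 hT).2.2)
  rw [h.Xfun_eq h0.le htT _ _ rfl rfl, h.sqH2pair_eq le_rfl hT]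
  refine J.a_priori_estimate hm hm1 hM hmlam hlamM hε1 hκ' hεκ hεM hc hC hG
    (fun s hs0 hsT => ?_) h0 htT
  rw [← h.sqH2pair_eq hs0.le hsT]
  have hle : sqH2pair (fun x => ρ s x - ρbar) (u s) ≤ ε := by
    refine ((Real.sqrt_le_left hε0.le).1 (hsm s hs0 hsT)).trans ?_
    exact pow_le_of_le_one hε0.le hε1 two_ne_zero
  exact le_trans (by gcongr) hεC
end
end

section
/- Uniform energy estimate for the nonlinearly damped p-system (Theorem 6, first part): Let 1 < r < 3 and let (ρ,u) be a classical solution of the nonlinearly damped p-system on ℝ × [0,∞) with initial datum (ρ₀,u₀). Then there is a constant C₁ > 0, independent of time, such that for all t ≥ 0: ‖(ρ,u)(t)‖²_{H¹} + ∫₀ᵗ ∫_ℝ ( |u(x,τ)|^{r+1} + |u(x,τ)|^{r−1}(|∂ₓρ(x,τ)|² + |∂ₓu(x,τ)|²) ) dx dτ ≤ C₁ ‖(ρ₀,u₀)‖²_{H¹}. -/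
open MeasureTheory

noncomputable section

/-- Squared `H¹` norm of a pair. -/
def sqH1pair (f g : ℝ → ℝ) : ℝ := sqH1 f + sqH1 g

/-- A classical solution of the nonlinearly damped `p`-system
`∂ₜρ + ∂ₓu = 0`, `∂ₜu + ∂ₓρ + |u|^{r−1}u = 0` on `ℝ × [0,∞)`: a smooth pair,
Schwartz in `x` locally uniformly in `t`, solving the system (time first argument). -/
structure IsPSystemSolution (r : ℝ) (ρ u : ℝ → ℝ → ℝ) : Prop where
  smooth_rho : ContDiff ℝ (⊤ : ℕ∞) (fun p : ℝ × ℝ => ρ p.1 p.2)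
  smooth_u : ContDiff ℝ (⊤ : ℕ∞) (fun p : ℝ × ℝ => u p.1 p.2)
  decay : ∀ (k m : ℕ) (T : ℝ), ∃ C : ℝ, ∀ t ∈ Set.Icc (0 : ℝ) T, ∀ x : ℝ,
      |x| ^ k * (|iteratedDeriv m (fun y => ρ t y) x| +
        |iteratedDeriv m (fun y => u t y) x|) ≤ C
  eq1 : ∀ t x : ℝ, 0 ≤ t →
      deriv (fun s => ρ s x) t + deriv (fun y => u t y) x = 0
  eq2 : ∀ t x : ℝ, 0 ≤ t →
      deriv (fun s => u s x) t + deriv (fun y => ρ t y) x +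
          |u t x| ^ (r - 1) * u t x = 0

open Function Set

/-- A continuous function of `(t, x)` that is bounded for `t ∈ [0, T]`. -/
structure IsBoundedOnSlab (T : ℝ) (g : ℝ → ℝ → ℝ) : Prop where
  continuous : Continuous (uncurry g)
  bound : ∃ C, ∀ t ∈ Icc (0 : ℝ) T, ∀ x, |g t x| ≤ C

/-- A continuous function of `(t, x)` that is `O(1 / (1 + x²))`, uniformly for `t ∈ [0, T]`. -/
structure DecaysOnSlab (T : ℝ) (g : ℝ → ℝ → ℝ) : Prop where
  continuous : Continuous (uncurry g)
  bound : ∃ C, ∀ t ∈ Icc (0 : ℝ) T, ∀ x, (1 + x ^ 2) * |g t x| ≤ C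

namespace DecaysOnSlab

variable {T : ℝ} {g h : ℝ → ℝ → ℝ}

theorem isBoundedOnSlab (hg : DecaysOnSlab T g) : IsBoundedOnSlab T g := by
  obtain ⟨C, hC⟩ := hg.bound
  refine ⟨hg.continuous, C, fun t ht x => ?_⟩
  nlinarith [hC t ht x, mul_nonneg (sq_nonneg x) (abs_nonneg (g t x))]

theorem add (hg : DecaysOnSlab T g) (hh : DecaysOnSlab T h) :
    DecaysOnSlab T fun t x => g t x + h t x := by
  obtain ⟨C, hC⟩ := hg.bound
  obtain ⟨D, hD⟩ := hh.bound
  refine ⟨hg.continuous.add hh.continuous, C + D, fun t ht x => ?_⟩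
  have h1 : (1 + x ^ 2) * |g t x + h t x| ≤ (1 + x ^ 2) * (|g t x| + |h t x|) :=
    mul_le_mul_of_nonneg_left (abs_add_le _ _) (by positivity)
  linarith [hC t ht x, hD t ht x]

theorem bounded_mul (hg : IsBoundedOnSlab T g) (hh : DecaysOnSlab T h) :
    DecaysOnSlab T fun t x => g t x * h t x := by
  obtain ⟨C, hC⟩ := hg.bound
  obtain ⟨D, hD⟩ := hh.bound
  refine ⟨hg.continuous.mul hh.continuous, C * D, fun t ht x => ?_⟩
  calc (1 + x ^ 2) * |g t x * h t x| = |g t x| * ((1 + x ^ 2) * |h t x|) := by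
        rw [abs_mul]; ring
    _ ≤ C * D := mul_le_mul (hC t ht x) (hD t ht x) (by positivity)
        ((abs_nonneg _).trans (hC t ht x))

theorem mul (hg : DecaysOnSlab T g) (hh : DecaysOnSlab T h) :
    DecaysOnSlab T fun t x => g t x * h t x :=
  bounded_mul hg.isBoundedOnSlab hh

theorem const_mul (c : ℝ) (hg : DecaysOnSlab T g) : DecaysOnSlab T fun t x => c * g t x :=
  bounded_mul ⟨continuous_const, |c|, fun _ _ _ => le_rfl⟩ hg

theorem sq (hg : DecaysOnSlab T g) : DecaysOnSlab T fun t x => g t x ^ 2 := by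
  simpa only [_root_.sq] using hg.mul hg

theorem integrable_prod (hg : DecaysOnSlab T g) (hT : 0 ≤ T) :
    Integrable (uncurry g) ((volume.restrict (uIoc 0 T)).prod volume) := by
  obtain ⟨C, hC⟩ := hg.bound
  have : IsFiniteMeasure (volume.restrict (uIoc 0 T)) := by
    rw [uIoc_of_le hT]
    infer_instance
  have hmaj : Integrable (fun p : ℝ × ℝ => C * (1 + p.2 ^ 2)⁻¹)
      ((volume.restrict (uIoc 0 T)).prod volume) :=
    (integrable_const C).mul_prod integrable_inv_one_add_sq
  refine hmaj.mono' hg.continuous.aestronglyMeasurable ?_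
  have hae : ∀ᵐ p ∂((volume.restrict (uIoc 0 T)).prod (volume : Measure ℝ)), p.1 ∈ uIoc 0 T :=
    Measure.quasiMeasurePreserving_fst.ae (ae_restrict_mem measurableSet_uIoc)
  filter_upwards [hae] with p hp
  rw [uIoc_of_le hT] at hp
  rw [Real.norm_eq_abs, ← div_eq_mul_inv, le_div_iff₀ (by positivity), mul_comm]
  exact hC p.1 ⟨hp.1.le, hp.2⟩ p.2

theorem integrable (hg : DecaysOnSlab T g) {t : ℝ} (ht : t ∈ Icc 0 T) :
    Integrable (g t) := by
  obtain ⟨C, hC⟩ := hg.bound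
  refine (integrable_inv_one_add_sq.const_mul C).mono'
    (hg.continuous.comp (Continuous.prodMk_right t)).aestronglyMeasurable (ae_of_all _ fun x => ?_)
  rw [Real.norm_eq_abs, ← div_eq_mul_inv, le_div_iff₀ (by positivity), mul_comm]
  exact hC t ht x

theorem intervalIntegrable_integral (hg : DecaysOnSlab T g) (hT : 0 ≤ T) :
    IntervalIntegrable (fun t => ∫ x, g t x) volume 0 T := by
  rw [intervalIntegrable_iff]
  exact (hg.integrable_prod hT).integral_prod_left

end DecaysOnSlab

/-- Integrated form of the balance law `∂ₜe + ∂ₓΦ = -D` on a slab. -/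
theorem integral_balance_law {T : ℝ} (hT : 0 ≤ T) {e D Φ Φx : ℝ → ℝ → ℝ}
    (he : DecaysOnSlab T e) (hD : DecaysOnSlab T D) (hΦ : DecaysOnSlab T Φ)
    (hΦx : DecaysOnSlab T Φx)
    (hderiv_t : ∀ t ∈ Icc 0 T, ∀ x, HasDerivAt (fun s => e s x) (-(D t x + Φx t x)) t)
    (hderiv_x : ∀ t ∈ Icc 0 T, ∀ x, HasDerivAt (Φ t) (Φx t x) x) :
    (∫ x, e T x) + ∫ t in (0 : ℝ)..T, ∫ x, D t x = ∫ x, e 0 x := by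
  have hsum := hD.add hΦx
  have hinner : ∀ x, ∫ t in (0 : ℝ)..T, (D t x + Φx t x) = e 0 x - e T x := fun x => by
    have hcont : Continuous fun t => D t x + Φx t x :=
      hsum.continuous.comp (Continuous.prodMk_left x)
    have h := intervalIntegral.integral_eq_sub_of_hasDerivAt
      (f := fun s => e s x) (fun t ht => hderiv_t t (by rwa [uIcc_of_le hT] at ht) x)
      (hcont.neg.intervalIntegrable 0 T)
    rw [intervalIntegral.integral_neg] at h
    linarith
  have houter : ∫ t in (0 : ℝ)..T, ∫ x, (D t x + Φx t x) = ∫ t in (0 : ℝ)..T, ∫ x, D t x := by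
    refine intervalIntegral.integral_congr fun t ht => ?_
    rw [uIcc_of_le hT] at ht
    rw [integral_add (hD.integrable ht) (hΦx.integrable ht),
      integral_eq_zero_of_hasDerivAt_of_integrable (hderiv_x t ht) (hΦx.integrable ht)
        (hΦ.integrable ht), add_zero]
  have hswap := intervalIntegral_integral_swap (hsum.integrable_prod hT)
  simp only [hinner] at hswap
  rw [houter, integral_sub (he.integrable (left_mem_Icc.2 hT))
    (he.integrable (right_mem_Icc.2 hT))] at hswap
  linarith

/-- One-dimensional Sobolev inequality `‖f‖_∞² ≤ ‖f‖²_{H¹}`. -/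
theorem sq_le_integral_sq_add_sq {f f' : ℝ → ℝ} (hf : ∀ x, HasDerivAt f (f' x) x)
    (hint : Integrable fun x => f x ^ 2) (hint' : Integrable fun x => f' x ^ 2)
    (hmul : Integrable fun x => f x * f' x) (x : ℝ) :
    f x ^ 2 ≤ ∫ y, (f y ^ 2 + f' y ^ 2) := by
  have hderiv : ∀ y, HasDerivAt (fun y => f y ^ 2) (2 * (f y * f' y)) y := fun y => by
    refine ((hf y).fun_pow 2).congr_deriv ?_
    norm_num [mul_assoc]
  have htend := tendsto_zero_of_hasDerivAt_of_integrableOn_Iic (a := x)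
    (fun y _ => hderiv y) (hmul.const_mul 2).integrableOn hint.integrableOn
  have hftc := integral_Iic_of_hasDerivAt_of_tendsto' (a := x)
    (fun y _ => hderiv y) (hmul.const_mul 2).integrableOn htend
  rw [sub_zero] at hftc
  rw [← hftc]
  refine (setIntegral_mono (hmul.const_mul 2).integrableOn (hint.add hint').integrableOn
    fun y => ?_).trans (setIntegral_le_integral (hint.add hint') (ae_of_all _ fun y => ?_))
  · simp only [Pi.add_apply]
    nlinarith [sq_nonneg (f y - f' y)]
  · simp only [Pi.add_apply, Pi.zero_apply]
    positivity

theorem hasDerivAt_abs_rpow_mul_self {p : ℝ} (hp : 0 < p) (x : ℝ) :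
    HasDerivAt (fun s : ℝ => |s| ^ p * s) ((p + 1) * |x| ^ p) x := by
  rcases eq_or_ne x 0 with rfl | hx
  · have hcont : Continuous fun s : ℝ => |s| ^ p :=
      continuous_abs.rpow_const fun _ => Or.inr hp.le
    rw [hasDerivAt_iff_tendsto_slope]
    simp only [abs_zero, Real.zero_rpow hp.ne', mul_zero]
    have hlim : Filter.Tendsto (fun s : ℝ => |s| ^ p) (nhdsWithin 0 {0}ᶜ) (nhds 0) := by
      have := hcont.tendsto 0
      simp only [abs_zero, Real.zero_rpow hp.ne'] at this
      exact this.mono_left nhdsWithin_le_nhds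
    refine hlim.congr' ?_
    filter_upwards [self_mem_nhdsWithin] with s hs
    have hs' : s ≠ 0 := hs
    simp [slope_def_field, hs']
  · have h := (((hasDerivAt_abs hx).rpow_const (p := p) (Or.inl (abs_ne_zero.2 hx))).mul
      (hasDerivAt_id x))
    refine h.congr_deriv ?_
    have hsign : (SignType.sign x : ℝ) * x = |x| := sign_mul_self x
    have hpow : |x| ^ p = |x| ^ (p - 1) * |x| := by
      rw [Real.rpow_sub_one (abs_ne_zero.2 hx), div_mul_cancel₀ _ (abs_ne_zero.2 hx)]
    simp only [id]
    linear_combination (p * |x| ^ (p - 1)) * hsign - p * hpow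

section PartialDerivatives

variable {F : ℝ → ℝ → ℝ} (hF : ContDiff ℝ (⊤ : ℕ∞) fun p : ℝ × ℝ => F p.1 p.2)
include hF

theorem hasDerivAt_partial_snd (t x : ℝ) :
    HasDerivAt (F t) (fderiv ℝ (fun p : ℝ × ℝ => F p.1 p.2) (t, x) (0, 1)) x :=
  HasFDerivAt.comp_hasDerivAt x (f := fun y : ℝ => (t, y))
    (hF.differentiable (by simp) (t, x)).hasFDerivAt
    ((hasDerivAt_const x t).prodMk (hasDerivAt_id x))

theorem hasDerivAt_partial_fst (t x : ℝ) :
    HasDerivAt (fun s => F s x) (fderiv ℝ (fun p : ℝ × ℝ => F p.1 p.2) (t, x) (1, 0)) t :=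
  HasFDerivAt.comp_hasDerivAt t (f := fun s : ℝ => (s, x))
    (hF.differentiable (by simp) (t, x)).hasFDerivAt
    ((hasDerivAt_id t).prodMk (hasDerivAt_const t x))

theorem contDiff_deriv_snd :
    ContDiff ℝ (⊤ : ℕ∞) fun p : ℝ × ℝ => deriv (F p.1) p.2 := by
  simp only [fun t x => (hasDerivAt_partial_snd hF t x).deriv]
  exact (hF.fderiv_right (m := (⊤ : ℕ∞)) (by simp)).clm_apply contDiff_const

theorem hasDerivAt_deriv_snd (t x : ℝ) : HasDerivAt (F t) (deriv (F t) x) x :=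
  (hasDerivAt_partial_snd hF t x).differentiableAt.hasDerivAt

/-- Mixed partial derivatives commute. -/
theorem hasDerivAt_fst_deriv_snd {G : ℝ → ℝ} {G' t x : ℝ}
    (hG : ∀ y, deriv (fun s => F s y) t = G y) (hG' : HasDerivAt G G' x) :
    HasDerivAt (fun s => deriv (F s) x) G' t := by
  set H := fderiv ℝ (fun p : ℝ × ℝ => F p.1 p.2)
  have hF2 : ContDiff ℝ 2 fun p : ℝ × ℝ => F p.1 p.2 := mod_cast contDiff_infty.1 hF 2
  have hHdiff : HasFDerivAt H (fderiv ℝ H (t, x)) (t, x) :=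
    ((hF2.fderiv_right (m := 1) (by norm_num)).differentiable (by simp) (t, x)).hasFDerivAt
  have hsymm := (hF2.contDiffAt (x := (t, x))).isSymmSndFDerivAt
    (by simp) (1, 0) (0, 1)
  have hx : HasDerivAt (fun y => H (t, y) (1, 0)) (fderiv ℝ H (t, x) (0, 1) (1, 0)) x := by
    have := (HasFDerivAt.comp_hasDerivAt x (f := fun y : ℝ => (t, y)) hHdiff
      ((hasDerivAt_const x t).prodMk (hasDerivAt_id x))).clm_apply
        (hasDerivAt_const x ((1, 0) : ℝ × ℝ))
    simpa using this
  have ht : HasDerivAt (fun s => H (s, x) (0, 1)) (fderiv ℝ H (t, x) (1, 0) (0, 1)) t := by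
    have := (HasFDerivAt.comp_hasDerivAt t (f := fun s : ℝ => (s, x)) hHdiff
      ((hasDerivAt_id t).prodMk (hasDerivAt_const t x))).clm_apply
        (hasDerivAt_const t ((0, 1) : ℝ × ℝ))
    simpa using this
  have hGH : G = fun y => H (t, y) (1, 0) :=
    funext fun y => (hG y).symm.trans (hasDerivAt_partial_fst hF t y).deriv
  have hval : G' = fderiv ℝ H (t, x) (1, 0) (0, 1) := by
    rw [hsymm]
    rw [hGH] at hG'
    exact hG'.unique hx
  rw [hval]
  simpa only [fun s => (hasDerivAt_partial_snd hF s x).deriv] using ht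

end PartialDerivatives

/-- The energy density `ρ² + u² + (∂ₓρ)² + (∂ₓu)² + (∂ₜρ)² + (∂ₜu)²` of a solution, with the time
derivatives replaced by space derivatives. -/
def energyDensity (r : ℝ) (ρ u : ℝ → ℝ → ℝ) (t x : ℝ) : ℝ :=
  ρ t x ^ 2 + u t x ^ 2 + deriv (ρ t) x ^ 2 + 2 * deriv (u t) x ^ 2 +
    (deriv (ρ t) x + |u t x| ^ (r - 1) * u t x) ^ 2

/-- The rate at which `energyDensity` is dissipated. -/
def dissipation (r : ℝ) (ρ u : ℝ → ℝ → ℝ) (t x : ℝ) : ℝ :=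
  |u t x| ^ (r - 1) * (2 * u t x ^ 2 + 2 * r * deriv (u t) x ^ 2 +
    2 * r * (deriv (ρ t) x + |u t x| ^ (r - 1) * u t x) ^ 2)

theorem dissipation_nonneg {r : ℝ} (hr : 0 ≤ r) (ρ u : ℝ → ℝ → ℝ) (t x : ℝ) :
    0 ≤ dissipation r ρ u t x := by
  unfold dissipation
  positivity

namespace IsPSystemSolution

variable {r : ℝ} {ρ u : ℝ → ℝ → ℝ} (hsol : IsPSystemSolution r ρ u)
include hsol

theorem exists_bound_iteratedDeriv (m : ℕ) (T : ℝ) :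
    ∃ C, ∀ t ∈ Icc (0 : ℝ) T, ∀ x, (1 + x ^ 2) * |iteratedDeriv m (ρ t) x| ≤ C ∧
      (1 + x ^ 2) * |iteratedDeriv m (u t) x| ≤ C := by
  obtain ⟨C, hC⟩ := hsol.decay 0 m T
  obtain ⟨D, hD⟩ := hsol.decay 2 m T
  refine ⟨C + D, fun t ht x => ?_⟩
  have h0 := hC t ht x
  have h2 := hD t ht x
  rw [pow_zero, one_mul] at h0
  rw [sq_abs] at h2
  constructor <;>
    nlinarith [abs_nonneg (iteratedDeriv m (ρ t) x), abs_nonneg (iteratedDeriv m (u t) x),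
      mul_nonneg (sq_nonneg x) (abs_nonneg (iteratedDeriv m (ρ t) x)),
      mul_nonneg (sq_nonneg x) (abs_nonneg (iteratedDeriv m (u t) x))]

theorem decaysOnSlab (T : ℝ) : DecaysOnSlab T ρ ∧ DecaysOnSlab T u := by
  obtain ⟨C, hC⟩ := hsol.exists_bound_iteratedDeriv 0 T
  simp only [iteratedDeriv_zero] at hC
  exact ⟨⟨hsol.smooth_rho.continuous, C, fun t ht x => (hC t ht x).1⟩,
    ⟨hsol.smooth_u.continuous, C, fun t ht x => (hC t ht x).2⟩⟩

theorem decaysOnSlab_deriv (T : ℝ) :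
    DecaysOnSlab T (fun t x => deriv (ρ t) x) ∧ DecaysOnSlab T (fun t x => deriv (u t) x) := by
  obtain ⟨C, hC⟩ := hsol.exists_bound_iteratedDeriv 1 T
  simp only [iteratedDeriv_one] at hC
  exact ⟨⟨(contDiff_deriv_snd hsol.smooth_rho).continuous, C, fun t ht x => (hC t ht x).1⟩,
    ⟨(contDiff_deriv_snd hsol.smooth_u).continuous, C, fun t ht x => (hC t ht x).2⟩⟩

theorem decaysOnSlab_deriv_deriv (T : ℝ) :
    DecaysOnSlab T (fun t x => deriv (deriv (ρ t)) x) ∧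
      DecaysOnSlab T (fun t x => deriv (deriv (u t)) x) := by
  obtain ⟨C, hC⟩ := hsol.exists_bound_iteratedDeriv 2 T
  simp only [iteratedDeriv_succ, iteratedDeriv_zero] at hC
  exact ⟨⟨(contDiff_deriv_snd (F := fun t x => deriv (ρ t) x)
      (contDiff_deriv_snd hsol.smooth_rho)).continuous, C, fun t ht x => (hC t ht x).1⟩,
    ⟨(contDiff_deriv_snd (F := fun t x => deriv (u t) x)
      (contDiff_deriv_snd hsol.smooth_u)).continuous, C, fun t ht x => (hC t ht x).2⟩⟩

theorem isBoundedOnSlab_abs_rpow (hr : 1 < r) (T : ℝ) :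
    IsBoundedOnSlab T fun t x => |u t x| ^ (r - 1) := by
  obtain ⟨C, hC⟩ := (hsol.decaysOnSlab T).2.isBoundedOnSlab.bound
  refine ⟨hsol.smooth_u.continuous.abs.rpow_const fun _ => Or.inr (by linarith),
    C ^ (r - 1), fun t ht x => ?_⟩
  rw [abs_of_nonneg (by positivity)]
  exact Real.rpow_le_rpow (abs_nonneg _) (hC t ht x) (by linarith)

theorem decaysOnSlab_deriv_add_damping (hr : 1 < r) (T : ℝ) :
    DecaysOnSlab T fun t x => deriv (ρ t) x + |u t x| ^ (r - 1) * u t x :=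
  (hsol.decaysOnSlab_deriv T).1.add
    (.bounded_mul (hsol.isBoundedOnSlab_abs_rpow hr T) (hsol.decaysOnSlab T).2)

theorem decaysOnSlab_energyDensity (hr : 1 < r) (T : ℝ) :
    DecaysOnSlab T (energyDensity r ρ u) :=
  ((((hsol.decaysOnSlab T).1.sq.add (hsol.decaysOnSlab T).2.sq).add
    (hsol.decaysOnSlab_deriv T).1.sq).add ((hsol.decaysOnSlab_deriv T).2.sq.const_mul 2)).add
      (hsol.decaysOnSlab_deriv_add_damping hr T).sq

theorem decaysOnSlab_dissipation (hr : 1 < r) (T : ℝ) :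
    DecaysOnSlab T (dissipation r ρ u) :=
  .bounded_mul (hsol.isBoundedOnSlab_abs_rpow hr T)
    ((((hsol.decaysOnSlab T).2.sq.const_mul 2).add
      ((hsol.decaysOnSlab_deriv T).2.sq.const_mul (2 * r))).add
        ((hsol.decaysOnSlab_deriv_add_damping hr T).sq.const_mul (2 * r)))

theorem hasDerivAt_deriv_add_damping (hr : 1 < r) (t x : ℝ) :
    HasDerivAt (fun y => deriv (ρ t) y + |u t y| ^ (r - 1) * u t y)
      (deriv (deriv (ρ t)) x + r * |u t x| ^ (r - 1) * deriv (u t) x) x := by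
  have h := (hasDerivAt_abs_rpow_mul_self (sub_pos.2 hr) (u t x)).comp x
    (hasDerivAt_deriv_snd hsol.smooth_u t x)
  rw [sub_add_cancel] at h
  exact (hasDerivAt_deriv_snd (F := fun t x => deriv (ρ t) x)
    (contDiff_deriv_snd hsol.smooth_rho) t x).add h

theorem energy_identity (hr : 1 < r) {T : ℝ} (hT : 0 ≤ T) :
    (∫ x, energyDensity r ρ u T x) + ∫ t in (0 : ℝ)..T, ∫ x, dissipation r ρ u t x =
      ∫ x, energyDensity r ρ u 0 x := by
  obtain ⟨hρ, hu⟩ := hsol.decaysOnSlab T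
  obtain ⟨hρx, hux⟩ := hsol.decaysOnSlab_deriv T
  obtain ⟨hρxx, huxx⟩ := hsol.decaysOnSlab_deriv_deriv T
  have hP := hsol.isBoundedOnSlab_abs_rpow hr T
  have hw := hsol.decaysOnSlab_deriv_add_damping hr T
  have hwx := hρxx.add ((DecaysOnSlab.bounded_mul hP hux).const_mul r)
  refine integral_balance_law hT (hsol.decaysOnSlab_energyDensity hr T)
    (hsol.decaysOnSlab_dissipation hr T)
    (((hρ.mul hu).add ((hρx.mul hux).add (hw.mul hux))).const_mul 2)
    ((((hρx.mul hu).add (hρ.mul hux)).add (((hρxx.mul hux).add (hρx.mul huxx)).add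
      ((hwx.mul hux).add (hw.mul huxx)))).const_mul 2) ?_ ?_
  · intro t ht x
    have hρt : ∀ y, deriv (fun s => ρ s y) t = -deriv (u t) y := fun y => by
      linarith [hsol.eq1 t y ht.1]
    have hut : ∀ y, deriv (fun s => u s y) t = -(deriv (ρ t) y + |u t y| ^ (r - 1) * u t y) :=
      fun y => by linarith [hsol.eq2 t y ht.1]
    have dρ : HasDerivAt (fun s => ρ s x) (-deriv (u t) x) t := by
      rw [← hρt]
      exact (hasDerivAt_partial_fst hsol.smooth_rho t x).differentiableAt.hasDerivAt
    have du : HasDerivAt (fun s => u s x) (-(deriv (ρ t) x + |u t x| ^ (r - 1) * u t x)) t := by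
      rw [← hut]
      exact (hasDerivAt_partial_fst hsol.smooth_u t x).differentiableAt.hasDerivAt
    have dρx := hasDerivAt_fst_deriv_snd hsol.smooth_rho hρt
      (hasDerivAt_deriv_snd (F := fun t x => deriv (u t) x)
        (contDiff_deriv_snd hsol.smooth_u) t x).fun_neg
    have dux := hasDerivAt_fst_deriv_snd hsol.smooth_u hut
      (hsol.hasDerivAt_deriv_add_damping hr t x).fun_neg
    have df := (hasDerivAt_abs_rpow_mul_self (sub_pos.2 hr) (u t x)).comp t du
    refine (((((dρ.fun_pow 2).add (du.fun_pow 2)).add (dρx.fun_pow 2)).add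
      ((dux.fun_pow 2).const_mul 2)).add ((dρx.add df).pow 2)).congr_deriv ?_
    simp only [dissipation, Pi.add_apply, comp_apply]
    push_cast
    ring
  · intro t _ x
    have dρ := hasDerivAt_deriv_snd hsol.smooth_rho t x
    have du := hasDerivAt_deriv_snd hsol.smooth_u t x
    have dρx := hasDerivAt_deriv_snd (F := fun t x => deriv (ρ t) x)
      (contDiff_deriv_snd hsol.smooth_rho) t x
    have dux := hasDerivAt_deriv_snd (F := fun t x => deriv (u t) x)
      (contDiff_deriv_snd hsol.smooth_u) t x
    have dw := hsol.hasDerivAt_deriv_add_damping hr t x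
    refine (((dρ.fun_mul du).fun_add ((dρx.fun_mul dux).fun_add
      (dw.fun_mul dux))).const_mul 2).congr_deriv ?_
    ring

theorem sq_le_integral_energyDensity (hr : 1 < r) {t : ℝ} (ht : 0 ≤ t) (x : ℝ) :
    u t x ^ 2 ≤ ∫ y, energyDensity r ρ u 0 y := by
  have htt : t ∈ Icc 0 t := right_mem_Icc.2 ht
  have hu := (hsol.decaysOnSlab t).2
  have hux := (hsol.decaysOnSlab_deriv t).2
  have hsob := sq_le_integral_sq_add_sq (hasDerivAt_deriv_snd hsol.smooth_u t)
    (hu.sq.integrable htt) (hux.sq.integrable htt) ((hu.mul hux).integrable htt) x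
  have hmono : ∫ y, (u t y ^ 2 + deriv (u t) y ^ 2) ≤ ∫ y, energyDensity r ρ u t y :=
    integral_mono ((hu.sq.add hux.sq).integrable htt)
      ((hsol.decaysOnSlab_energyDensity hr t).integrable htt) fun y => by
        simp only [energyDensity]
        nlinarith [sq_nonneg (ρ t y), sq_nonneg (deriv (ρ t) y), sq_nonneg (deriv (u t) y),
          sq_nonneg (deriv (ρ t) y + |u t y| ^ (r - 1) * u t y)]
  have hdiss : 0 ≤ ∫ s in (0 : ℝ)..t, ∫ y, dissipation r ρ u s y :=
    intervalIntegral.integral_nonneg ht fun s _ =>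
      integral_nonneg fun y => dissipation_nonneg (by linarith) ρ u s y
  linarith [hsol.energy_identity hr ht]

theorem sqH1pair_eq {t : ℝ} (ht : 0 ≤ t) :
    sqH1pair (ρ t) (u t) =
      ∫ x, (ρ t x ^ 2 + deriv (ρ t) x ^ 2 + (u t x ^ 2 + deriv (u t) x ^ 2)) := by
  have htt : t ∈ Icc 0 t := right_mem_Icc.2 ht
  have hρ := (hsol.decaysOnSlab t).1.sq
  have hu := (hsol.decaysOnSlab t).2.sq
  have hρx := (hsol.decaysOnSlab_deriv t).1.sq
  have hux := (hsol.decaysOnSlab_deriv t).2.sq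
  rw [integral_add ((hρ.add hρx).integrable htt) ((hu.add hux).integrable htt),
    integral_add (hρ.integrable htt) (hρx.integrable htt),
    integral_add (hu.integrable htt) (hux.integrable htt)]
  rfl

end IsPSystemSolution

/-- **Theorem 6, first part.** Uniform energy estimate for the
nonlinearly damped `p`-system: for `1 < r < 3` and any classical solution there is
`C₁ > 0`, independent of time, with
`‖(ρ,u)(t)‖²_{H¹} + ∫₀ᵗ∫_ℝ (|u|^{r+1} + |u|^{r−1}(|∂ₓρ|² + |∂ₓu|²)) ≤ C₁‖(ρ₀,u₀)‖²_{H¹}`. -/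
theorem p_system_uniform_energy_estimate
    (r : ℝ) (hr₁ : 1 < r) (hr₂ : r < 3)
    (ρ u : ℝ → ℝ → ℝ) (hsol : IsPSystemSolution r ρ u) :
    ∃ C₁ : ℝ, 0 < C₁ ∧
      ∀ t : ℝ, 0 ≤ t →
        sqH1pair (ρ t) (u t) +
            (∫ τ in (0 : ℝ)..t, ∫ x,
              (|u τ x| ^ (r + 1) +
                |u τ x| ^ (r - 1) * ((deriv (ρ τ) x) ^ 2 + (deriv (u τ) x) ^ 2))) ≤
          C₁ * sqH1pair (ρ 0) (u 0) := by
  have hr0 : 0 < r - 1 := sub_pos.2 hr₁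
  set b := √(∫ y, energyDensity r ρ u 0 y) ^ (r - 1)
  have hpow : ∀ t x, |u t x| ^ (r + 1) = |u t x| ^ (r - 1) * u t x ^ 2 := fun t x => by
    rw [← sq_abs (u t x), ← Real.rpow_natCast, ← Real.rpow_add' (abs_nonneg _) (by
      push_cast; linarith)]
    congr 1
    push_cast
    ring
  have hPb : ∀ t, 0 ≤ t → ∀ x, |u t x| ^ (r - 1) ≤ b := fun t ht x =>
    Real.rpow_le_rpow (abs_nonneg _)
      (Real.abs_le_sqrt (hsol.sq_le_integral_energyDensity hr₁ ht x)) hr0.le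
  have hdamp : ∀ t, 0 ≤ t → ∀ x,
      (|u t x| ^ (r - 1) * u t x) ^ 2 ≤ b ^ 2 * u t x ^ 2 := fun t ht x => by
    rw [mul_pow]
    have := hPb t ht x
    gcongr
  refine ⟨(1 + 2 * b ^ 2) * (3 + 2 * b ^ 2), by positivity, fun t ht => ?_⟩
  have h00 : (0 : ℝ) ∈ Icc 0 (0 : ℝ) := left_mem_Icc.2 le_rfl
  have htt : t ∈ Icc 0 t := right_mem_Icc.2 ht
  have hN : sqH1pair (ρ t) (u t) ≤ ∫ x, energyDensity r ρ u t x := by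
    rw [hsol.sqH1pair_eq ht]
    refine integral_mono (DecaysOnSlab.integrable (T := t)
      (((hsol.decaysOnSlab t).1.sq.add (hsol.decaysOnSlab_deriv t).1.sq).add
      ((hsol.decaysOnSlab t).2.sq.add (hsol.decaysOnSlab_deriv t).2.sq)) htt)
      ((hsol.decaysOnSlab_energyDensity hr₁ t).integrable htt) fun x => ?_
    simp only [energyDensity]
    nlinarith [sq_nonneg (deriv (u t) x),
      sq_nonneg (deriv (ρ t) x + |u t x| ^ (r - 1) * u t x)]
  have hE0 : ∫ x, energyDensity r ρ u 0 x ≤ (3 + 2 * b ^ 2) * sqH1pair (ρ 0) (u 0) := by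
    rw [hsol.sqH1pair_eq le_rfl, ← integral_const_mul]
    refine integral_mono ((hsol.decaysOnSlab_energyDensity hr₁ 0).integrable h00)
      (DecaysOnSlab.integrable (T := 0) (DecaysOnSlab.const_mul _
      (((hsol.decaysOnSlab 0).1.sq.add (hsol.decaysOnSlab_deriv 0).1.sq).add
      ((hsol.decaysOnSlab 0).2.sq.add (hsol.decaysOnSlab_deriv 0).2.sq))) h00) fun x => ?_
    simp only [energyDensity]
    have h1 := hdamp 0 le_rfl x
    have h2 : ∀ a : ℝ, 0 ≤ b ^ 2 * a ^ 2 := fun a => by positivity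
    nlinarith [sq_nonneg (deriv (ρ 0) x - |u 0 x| ^ (r - 1) * u 0 x), h2 (ρ 0 x),
      h2 (u 0 x), h2 (deriv (ρ 0) x), h2 (deriv (u 0) x), sq_nonneg (ρ 0 x),
      sq_nonneg (u 0 x), sq_nonneg (deriv (ρ 0) x), sq_nonneg (deriv (u 0) x)]
  have hdecay : DecaysOnSlab t fun τ x => |u τ x| ^ (r + 1) +
      |u τ x| ^ (r - 1) * ((deriv (ρ τ) x) ^ 2 + (deriv (u τ) x) ^ 2) := by
    simp only [hpow]
    have hP := hsol.isBoundedOnSlab_abs_rpow hr₁ t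
    exact (DecaysOnSlab.bounded_mul hP (hsol.decaysOnSlab t).2.sq).add
      (.bounded_mul hP ((hsol.decaysOnSlab_deriv t).1.sq.add (hsol.decaysOnSlab_deriv t).2.sq))
  have hdiss := (hsol.decaysOnSlab_dissipation hr₁ t).const_mul (1 + 2 * b ^ 2)
  have hI : (∫ τ in (0 : ℝ)..t, ∫ x, (|u τ x| ^ (r + 1) +
      |u τ x| ^ (r - 1) * ((deriv (ρ τ) x) ^ 2 + (deriv (u τ) x) ^ 2))) ≤
      (1 + 2 * b ^ 2) * ∫ τ in (0 : ℝ)..t, ∫ x, dissipation r ρ u τ x := by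
    rw [← intervalIntegral.integral_const_mul]
    simp only [← integral_const_mul]
    refine intervalIntegral.integral_mono_on ht (hdecay.intervalIntegrable_integral ht)
      (hdiss.intervalIntegrable_integral ht) fun τ hτ => ?_
    refine integral_mono (hdecay.integrable hτ) (hdiss.integrable hτ) fun x => ?_
    simp only [hpow, dissipation]
    rw [← mul_add, mul_left_comm]
    refine mul_le_mul_of_nonneg_left ?_ (by positivity)
    have h1 := hdamp τ hτ.1 x
    set f := |u τ x| ^ (r - 1) * u τ x
    have h2 : 0 ≤ (r - 1) * deriv (u τ) x ^ 2 := by positivity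
    have h3 : 0 ≤ (r - 1) * (deriv (ρ τ) x + f) ^ 2 := by positivity
    have h4 : u τ x ^ 2 + (deriv (ρ τ) x ^ 2 + deriv (u τ) x ^ 2) ≤
        (1 + 2 * b ^ 2) * (2 * u τ x ^ 2) +
          (2 * r * deriv (u τ) x ^ 2 + 2 * r * (deriv (ρ τ) x + f) ^ 2) := by
      nlinarith [sq_nonneg (deriv (ρ τ) x + 2 * f), sq_nonneg (deriv (u τ) x),
        sq_nonneg (u τ x), sq_nonneg f]
    have h5 : 0 ≤ 2 * b ^ 2 *
        (2 * r * deriv (u τ) x ^ 2 + 2 * r * (deriv (ρ τ) x + f) ^ 2) := by positivity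
    linarith
  have hEt : 0 ≤ ∫ x, energyDensity r ρ u t x :=
    integral_nonneg fun x => by simp only [energyDensity, Pi.zero_apply]; positivity
  calc _ ≤ (1 + 2 * b ^ 2) * ((∫ x, energyDensity r ρ u t x) +
        ∫ τ in (0 : ℝ)..t, ∫ x, dissipation r ρ u τ x) := by
        nlinarith [mul_nonneg (sq_nonneg b) hEt]
    _ ≤ (1 + 2 * b ^ 2) * ((3 + 2 * b ^ 2) * sqH1pair (ρ 0) (u 0)) := by
        rw [hsol.energy_identity hr₁ ht]
        gcongr
    _ = _ := by ring
end
end
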